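/- Let |θ⟩ ∈ ℋ ⊗ ℋ_E be a unit vector, ρ := tr_E(|θ⟩⟨θ|) its reduced state on ℋ, and assume λ_max(ρ) < 1. Let {M_n} be a family of sets satisfying properties 1–5 on the tensor powers of ℋ. Let m = m(n) and r = r(n) be sequences of non-negative integers with m(n) = o(n) and r(n) = o(n), and for each n let |Ψ_{n,m,r}⟩ ∈ |θ⟩^{[⊗, n−m, r]} be an almost power state along |θ⟩ in (ℋ⊗ℋ_E)^{⊗(n−m)}. Then E_M^∞(ρ) ≤ liminf_{n→∞} (1/n) E_{M_{n−m}}( tr_E(|Ψ_{n,m,r}⟩⟨Ψ_{n,m,r}|) ), where tr_E traces out all n−m environment factors ℋ_E. -/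

import Mathlib

open scoped BigOperators
open Filter ComplexOrder

noncomputable section

namespace GQSL

variable {I : Type*} [Fintype I] [DecidableEq I]

/-- A quantum state: a positive semidefinite matrix of unit trace. -/
def IsState (ρ : Matrix I I ℂ) : Prop := ρ.PosSemidef ∧ ρ.trace = 1

/-- The `n`-fold tensor power of an operator, realized on `Fin n → I` indices. -/
def tpow (ρ : Matrix I I ℂ) (n : ℕ) : Matrix (Fin n → I) (Fin n → I) ℂ :=
  fun x y => ∏ i, ρ (x i) (y i)

/-- Functional calculus for Hermitian matrices (junk value `0` otherwise). -/
def fcal (f : ℝ → ℝ) (A : Matrix I I ℂ) : Matrix I I ℂ :=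
  if hA : A.IsHermitian then
    (hA.eigenvectorUnitary : Matrix I I ℂ) *
      Matrix.diagonal (fun i => (f (hA.eigenvalues i) : ℂ)) *
      star (hA.eigenvectorUnitary : Matrix I I ℂ)
  else 0

/-- Base-2 matrix logarithm, computed on the support. -/
def mlog (A : Matrix I I ℂ) : Matrix I I ℂ :=
  fcal (fun x => if 0 < x then Real.logb 2 x else 0) A

/-- Real matrix power, computed on the support (generalized inverse powers). -/
def mpow (A : Matrix I I ℂ) (t : ℝ) : Matrix I I ℂ :=
  fcal (fun x => if 0 < x then x ^ t else 0) A

/-- Matrix square root of a positive semidefinite matrix. -/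
def msqrt (A : Matrix I I ℂ) : Matrix I I ℂ := fcal Real.sqrt A

/-- Trace norm `‖A‖₁ = tr √(AᴴA)`. -/
def trNorm (A : Matrix I I ℂ) : ℝ := ((msqrt (A.conjTranspose * A)).trace).re

/-- Trace of the positive part of a Hermitian matrix: the sum of its positive eigenvalues. -/
def trPos (A : Matrix I I ℂ) : ℝ := ((fcal (fun x => max x 0) A).trace).re

/-- Fidelity `F(A,B) = tr √(√A B √A)`. -/
def fid (A B : Matrix I I ℂ) : ℝ := ((msqrt (msqrt A * B * msqrt A)).trace).re

/-- Von Neumann entropy (base 2). -/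
def vnEnt (A : Matrix I I ℂ) : ℝ := -((A * mlog A).trace).re

/-- `supp ρ ⊆ supp σ`, expressed via kernels. -/
def SuppLe (ρ σ : Matrix I I ℂ) : Prop := ∀ v, σ.mulVec v = 0 → ρ.mulVec v = 0

/-- Quantum relative entropy `S(ρ‖σ) = tr(ρ(log₂ρ − log₂σ))` (finite-value formula,
meaningful when `SuppLe ρ σ` holds). -/
def relEnt (ρ σ : Matrix I I ℂ) : ℝ := ((ρ * (mlog ρ - mlog σ)).trace).re

/-- `E_M(ρ) = inf {S(ρ‖σ) : σ ∈ M}`; states `σ` violating the support condition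
have `S(ρ‖σ) = +∞` and hence do not contribute to the infimum. -/
def EMset (M : Set (Matrix I I ℂ)) (ρ : Matrix I I ℂ) : ℝ :=
  sInf {x | ∃ σ ∈ M, SuppLe ρ σ ∧ x = relEnt ρ σ}

/-- Max-relative entropy `S_max(ρ‖σ) = inf {s : ρ ≤ 2^s σ}`. -/
def Smax (ρ σ : Matrix I I ℂ) : ℝ := sInf {s : ℝ | (((2:ℝ) ^ s) • σ - ρ).PosSemidef}

/-- Log robustness with respect to a set `M`. -/
def LR (M : Set (Matrix I I ℂ)) (ρ : Matrix I I ℂ) : ℝ :=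
  sInf {x | ∃ σ ∈ M, x = Smax ρ σ}

/-- Smoothed log robustness. -/
def LReps (M : Set (Matrix I I ℂ)) (ε : ℝ) (ρ : Matrix I I ℂ) : ℝ :=
  sInf {x | ∃ ρ', IsState ρ' ∧ trNorm (ρ' - ρ) ≤ ε ∧ x = LR M ρ'}

/-- Partial trace over the `k`-th tensor factor. -/
def ptraceAt {n : ℕ} (k : Fin (n + 1)) (ρ : Matrix (Fin (n + 1) → I) (Fin (n + 1) → I) ℂ) :
    Matrix (Fin n → I) (Fin n → I) ℂ :=
  fun x y => ∑ a : I, ρ (k.insertNth a x) (k.insertNth a y)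

/-- Tensor product of operators on `n` and `m` copies. -/
def tprod {n m : ℕ} (ρ : Matrix (Fin n → I) (Fin n → I) ℂ)
    (ν : Matrix (Fin m → I) (Fin m → I) ℂ) :
    Matrix (Fin (n + m) → I) (Fin (n + m) → I) ℂ :=
  fun x y => ρ (fun i => x (Fin.castAdd m i)) (fun i => y (Fin.castAdd m i)) *
    ν (fun j => x (Fin.natAdd n j)) (fun j => y (Fin.natAdd n j))

/-- Conjugation `P_π ρ P_π†` by the permutation unitary. -/
def permute {n : ℕ} (π : Equiv.Perm (Fin n)) (ρ : Matrix (Fin n → I) (Fin n → I) ℂ) :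
    Matrix (Fin n → I) (Fin n → I) ℂ :=
  fun x y => ρ (x ∘ π) (y ∘ π)

/-- A family of sets of states satisfying properties 1–5, with `σ` the fixed
full-rank state of property 2. -/
structure GoodFamily {d : ℕ} (σ : Matrix (Fin d) (Fin d) ℂ)
    (M : ∀ n : ℕ, Set (Matrix (Fin n → Fin d) (Fin n → Fin d) ℂ)) : Prop where
  states : ∀ n, ∀ ρ ∈ M n, IsState ρ
  convex : ∀ n, Convex ℝ (M n)
  closed : ∀ n, IsClosed (M n)
  sigma_state : IsState σ
  sigma_posdef : σ.PosDef
  sigma_mem : ∀ n, tpow σ n ∈ M n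
  ptrace_mem : ∀ n (k : Fin (n + 1)), ∀ ρ ∈ M (n + 1), ptraceAt k ρ ∈ M n
  tprod_mem : ∀ n m, ∀ ρ ∈ M n, ∀ ν ∈ M m, tprod ρ ν ∈ M (n + m)
  perm_mem : ∀ n (π : Equiv.Perm (Fin n)), ∀ ρ ∈ M n, permute π ρ ∈ M n

/-- The rank-one operator `|f⟩⟨f|`. -/
def vecOp {J : Type*} (f : J → ℂ) : Matrix J J ℂ := fun x y => f x * star (f y)

/-- Squared ℓ²-norm of a vector. -/
def vecNormSq {J : Type*} [Fintype J] (f : J → ℂ) : ℝ := ∑ x, Complex.normSq (f x)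

/-- ℓ²-norm of a vector. -/
def l2norm {J : Type*} [Fintype J] (f : J → ℂ) : ℝ := Real.sqrt (vecNormSq f)

/-- Membership in the symmetric subspace. -/
def IsSymVec {J : Type*} {N : ℕ} (f : (Fin N → J) → ℂ) : Prop :=
  ∀ (π : Equiv.Perm (Fin N)) (x : Fin N → J), f (x ∘ π) = f x

/-- Unnormalized symmetrization `Σ_π P_π ψ`. -/
def symmetrize {J : Type*} {N : ℕ} (ψ : (Fin N → J) → ℂ) : (Fin N → J) → ℂ :=
  fun x => ∑ π : Equiv.Perm (Fin N), ψ (x ∘ π)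

/-- Normalized symmetrization `Sym(ψ)`. -/
def SymOf {J : Type*} [Fintype J] {N : ℕ} (ψ : (Fin N → J) → ℂ) : (Fin N → J) → ℂ :=
  ((l2norm (symmetrize ψ) : ℂ))⁻¹ • symmetrize ψ

/-- Partial trace over the first `m` of `m + k` tensor factors. -/
def ptraceFirst {J : Type*} [Fintype J] [DecidableEq J] {m k : ℕ}
    (ρ : Matrix (Fin (m + k) → J) (Fin (m + k) → J) ℂ) :
    Matrix (Fin k → J) (Fin k → J) ℂ :=
  fun x y => ∑ a : Fin m → J, ρ (Fin.append a x) (Fin.append a y)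

/-- Partial trace over the environment components of `N` system–environment pairs. -/
def ptraceE {A E : Type*} [Fintype A] [Fintype E] {N : ℕ}
    (ρ : Matrix (Fin N → A × E) (Fin N → A × E) ℂ) :
    Matrix (Fin N → A) (Fin N → A) ℂ :=
  fun x y => ∑ e : Fin N → E, ρ (fun i => (x i, e i)) (fun i => (y i, e i))

/-- The set of `(N choose r)`-i.i.d. vectors along `θ`: vectors which are `θ` on
`N − r` of the positions (the permutations of `θ^{⊗(N−r)} ⊗ ψ_r`). -/
def powVecSet {J : Type*} (θ : J → ℂ) (N r : ℕ) : Set ((Fin N → J) → ℂ) :=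
  {f | ∃ S : Finset (Fin N), S.card = N - r ∧
    ∃ ψ : ({i : Fin N // i ∉ S} → J) → ℂ,
      f = fun x => (∏ i ∈ S, θ (x i)) * ψ (fun j => x j.1)}

/-- Almost power states along `θ`: `|θ⟩^{[⊗,N,r]} = Sym(ℋ^{⊗N}) ∩ span V(ℋ^{⊗N}, θ^{⊗N−r})`. -/
def almostPower {J : Type*} (θ : J → ℂ) (N r : ℕ) : Set ((Fin N → J) → ℂ) :=
  {f | IsSymVec f ∧ f ∈ Submodule.span ℂ (powVecSet θ N r)}

/-- `η ⊗ θ^{⊗(N−k)}`: the vector `η` on the first `k` slots and `θ` on the rest. -/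
def etaTensor {J : Type*} {N k : ℕ} (h : k ≤ N) (η : (Fin k → J) → ℂ) (θ : J → ℂ) :
    (Fin N → J) → ℂ :=
  fun x => η (fun i => x (Fin.castLE h i)) * ∏ i : Fin N, if (i : ℕ) < k then 1 else θ (x i)

/-- `η` lies in the `k`-fold tensor power of the orthogonal complement of `θ`:
the contraction of `η` with `⟨θ|` at any slot vanishes. -/
def InPerpPow {J : Type*} [Fintype J] [DecidableEq J] {k : ℕ} (θ : J → ℂ)
    (η : (Fin k → J) → ℂ) : Prop :=
  ∀ (j : Fin k) (z : Fin k → J), ∑ a : J, star (θ a) * η (Function.update z j a) = 0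

/-- Binary Shannon entropy. -/
def binEnt (x : ℝ) : ℝ := -(x * Real.logb 2 x) - (1 - x) * Real.logb 2 (1 - x)

/-- Product operator `σ₁ ⊗ ⋯ ⊗ σ_k` of a `k`-partite system. -/
def prodOp {k : ℕ} {ι : Fin k → Type*} [∀ i, Fintype (ι i)]
    (σs : ∀ i, Matrix (ι i) (ι i) ℂ) : Matrix (∀ i, ι i) (∀ i, ι i) ℂ :=
  fun x y => ∏ i, σs i (x i) (y i)

/-- Separability of a `k`-partite state: a finite convex combination of product states. -/
def IsSeparable {k : ℕ} {ι : Fin k → Type*} [∀ i, Fintype (ι i)]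
    (ρ : Matrix (∀ i, ι i) (∀ i, ι i) ℂ) : Prop :=
  ∃ (m : ℕ) (p : Fin m → ℝ) (σs : Fin m → ∀ i, Matrix (ι i) (ι i) ℂ),
    (∀ j, 0 ≤ p j) ∧ (∑ j, p j = 1) ∧ (∀ j i, IsState (σs j i)) ∧
    ρ = ∑ j, p j • prodOp (σs j)

/-- Relative entropy of entanglement `E_R(ρ) = inf {S(ρ‖ω) : ω separable}`. -/
def ERel {k : ℕ} {ι : Fin k → Type*} [∀ i, Fintype (ι i)] [∀ i, DecidableEq (ι i)]
    (ρ : Matrix (∀ i, ι i) (∀ i, ι i) ℂ) : ℝ :=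
  sInf {x | ∃ ω, IsSeparable ω ∧ SuppLe ρ ω ∧ x = relEnt ρ ω}

/-- `ρ^{⊗n}` of a `k`-partite state, viewed as a `k`-partite state where the `i`-th
party holds the `n` copies of its system. -/
def tpowMulti {k : ℕ} {d : Fin k → ℕ} (ρ : Matrix (∀ i, Fin (d i)) (∀ i, Fin (d i)) ℂ)
    (n : ℕ) : Matrix (∀ i, Fin n → Fin (d i)) (∀ i, Fin n → Fin (d i)) ℂ :=
  fun x y => ∏ t : Fin n, ρ (fun i => x i t) (fun i => y i t)

/-- `ρ^{⊗n}` of a bipartite state in the grouped bipartition `A^{⊗n} : B^{⊗n}`. -/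
def tpowBi {A B : Type*} [Fintype A] [Fintype B]
    (ρ : Matrix (A × B) (A × B) ℂ) (n : ℕ) :
    Matrix ((Fin n → A) × (Fin n → B)) ((Fin n → A) × (Fin n → B)) ℂ :=
  fun x y => ∏ i, ρ (x.1 i, x.2 i) (y.1 i, y.2 i)

/-- `k`-extendibility of a bipartite state. -/
def IsKExtendible {A B : Type*} [Fintype A] [Fintype B] (k : ℕ)
    (σ : Matrix (A × B) (A × B) ℂ) : Prop :=
  ∃ σ' : Matrix (A × (Fin k → B)) (A × (Fin k → B)) ℂ,
    IsState σ' ∧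
    (∀ (π : Equiv.Perm (Fin k)) (p q : A × (Fin k → B)),
      σ' (p.1, p.2 ∘ π) (q.1, q.2 ∘ π) = σ' p q) ∧
    (∀ p q : A × B, σ p q =
      ∑ f : {i : Fin k // (i : ℕ) ≠ 0} → B,
        σ' (p.1, fun i => if h : (i : ℕ) = 0 then p.2 else f ⟨i, h⟩)
           (q.1, fun i => if h : (i : ℕ) = 0 then q.2 else f ⟨i, h⟩))

section MatrixLog

open scoped MatrixOrder Matrix.Norms.L2Operator

lemma fcal_eq_cfc (f : ℝ → ℝ) {A : Matrix I I ℂ} (hA : A.IsHermitian) : fcal f A = cfc f A := by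
  rw [hA.cfc_eq, fcal, dif_pos hA, Matrix.IsHermitian.cfc, Unitary.conjStarAlgAut_apply]
  rfl

lemma continuousOn_spectrum (f : ℝ → ℝ) (A : Matrix I I ℂ) : ContinuousOn f (spectrum ℝ A) :=
  (Matrix.finite_real_spectrum).continuousOn f

lemma mlog_eq_log {A : Matrix I I ℂ} (hA : A.PosDef) :
    mlog A = (Real.log 2)⁻¹ • CFC.log A := by
  rw [mlog, fcal_eq_cfc _ hA.isHermitian, CFC.log, ← cfc_smul _ _ _ (continuousOn_spectrum _ _)]
  refine cfc_congr fun x hx => ?_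
  have hx0 : 0 < x := hA.isStrictlyPositive.spectrum_pos hx
  simp [hx0, Real.logb, div_eq_inv_mul]

lemma mlog_mono {A B : Matrix I I ℂ} (hA : A.PosDef) (hAB : A ≤ B) : mlog A ≤ mlog B := by
  have hB : B.PosDef := Matrix.isStrictlyPositive_iff_posDef.1 (hA.isStrictlyPositive.of_le hAB)
  rw [mlog_eq_log hA, mlog_eq_log hB]
  exact smul_le_smul_of_nonneg_left (CFC.log_le_log hAB hA.isStrictlyPositive)
    (inv_nonneg.2 (Real.log_nonneg one_le_two))

lemma mlog_smul {A : Matrix I I ℂ} (hA : A.PosDef) {c : ℝ} (hc : 0 < c) :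
    mlog (c • A) = Real.logb 2 c • (1 : Matrix I I ℂ) + mlog A := by
  have hcA : (c • A).PosDef := hA.smul hc
  rw [mlog_eq_log hA, mlog_eq_log hcA, CFC.log_smul' A hc hA.isStrictlyPositive, smul_add,
    Algebra.algebraMap_eq_smul_one, smul_smul, Real.logb, div_eq_inv_mul]

lemma mlog_one : mlog (1 : Matrix I I ℂ) = 0 := by
  rw [mlog_eq_log Matrix.PosDef.one, CFC.log_one, smul_zero]

lemma exists_pos_smul_one_le {A : Matrix I I ℂ} (hA : A.PosDef) :
    ∃ c : ℝ, 0 < c ∧ c • (1 : Matrix I I ℂ) ≤ A := by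
  rcases isEmpty_or_nonempty I with h | h
  · exact ⟨1, one_pos, le_of_eq (Subsingleton.elim _ _)⟩
  · obtain ⟨c, hc, h⟩ := (CFC.exists_pos_algebraMap_le_iff (A := Matrix I I ℂ)
      hA.isHermitian).2 fun x hx => hA.isStrictlyPositive.spectrum_pos hx
    exact ⟨c, hc, by rwa [← Algebra.algebraMap_eq_smul_one]⟩

lemma trace_mul_re_nonneg {A B : Matrix I I ℂ} (hA : 0 ≤ A) (hB : 0 ≤ B) :
    0 ≤ ((A * B).trace).re := by
  obtain ⟨C, rfl⟩ := CStarAlgebra.nonneg_iff_eq_star_mul_self.1 hA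
  rw [Matrix.star_eq_conjTranspose, Matrix.mul_assoc, Matrix.trace_mul_comm]
  exact (Complex.le_def.1
    ((Matrix.nonneg_iff_posSemidef.1 hB).mul_mul_conjTranspose_same C).trace_nonneg).1

lemma trace_mul_re_mono {A B C : Matrix I I ℂ} (hA : 0 ≤ A) (hBC : B ≤ C) :
    ((A * B).trace).re ≤ ((A * C).trace).re := by
  have := trace_mul_re_nonneg hA (sub_nonneg.2 hBC)
  rw [Matrix.mul_sub, Matrix.trace_sub, Complex.sub_re] at this
  linarith

lemma trace_mul_re_le_of_dominated {D W G : Matrix I I ℂ} {L : ℝ} (hD : D ≤ W) (hD' : -W ≤ D)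
    (hG : G ≤ L • 1) (hG' : -(L • 1) ≤ G) : |((D * G).trace).re| ≤ L * (W.trace).re := by
  have key : ∀ D : Matrix I I ℂ, D ≤ W → -W ≤ D →
      ((D * G).trace).re ≤ L * (W.trace).re := by
    intro D hD hD'
    have h1 := trace_mul_re_nonneg (sub_nonneg.2 hD) (sub_nonneg.2 hG')
    have h2 := trace_mul_re_nonneg (sub_nonneg.2 hD') (sub_nonneg.2 hG)
    simp only [Matrix.mul_sub, Matrix.sub_mul, Matrix.mul_neg, Matrix.neg_mul, Matrix.trace_sub,
      Matrix.trace_neg, Complex.sub_re, Complex.neg_re, Matrix.mul_smul, Matrix.mul_one,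
      Matrix.trace_smul, Complex.real_smul, Complex.re_ofReal_mul] at h1 h2
    linarith
  have h := key (-D) (neg_le.1 hD') (neg_le_neg hD)
  rw [Matrix.neg_mul, Matrix.trace_neg, Complex.neg_re] at h
  exact abs_le.2 ⟨by linarith, key D hD hD'⟩

lemma trace_fcal_mul_fcal (f g : ℝ → ℝ) {A B : Matrix I I ℂ} (hA : A.IsHermitian)
    (hB : B.IsHermitian) : ((fcal f A * fcal g B).trace).re =
      ∑ i, ∑ j, Complex.normSq ((star (hA.eigenvectorUnitary : Matrix I I ℂ) *
        (hB.eigenvectorUnitary : Matrix I I ℂ)) i j) *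
          (f (hA.eigenvalues i) * g (hB.eigenvalues j)) := by
  rw [fcal, dif_pos hA, fcal, dif_pos hB]
  set U := (hA.eigenvectorUnitary : Matrix I I ℂ)
  set V := (hB.eigenvectorUnitary : Matrix I I ℂ)
  set a := Matrix.diagonal (fun i => (f (hA.eigenvalues i) : ℂ))
  set b := Matrix.diagonal (fun i => (g (hB.eigenvalues i) : ℂ))
  have h : (U * a * star U * (V * b * star V)).trace =
      (a * ((star U * V) * b * star (star U * V))).trace := by
    rw [star_mul, star_star]
    simp only [Matrix.mul_assoc]
    rw [Matrix.trace_mul_comm]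
    simp only [Matrix.mul_assoc]
  rw [h]
  simp only [a, b, Matrix.trace, Matrix.diag, Matrix.diagonal_mul, Complex.re_sum]
  refine Finset.sum_congr rfl fun i _ => ?_
  rw [Complex.re_ofReal_mul, Matrix.mul_apply, Complex.re_sum, Finset.mul_sum]
  refine Finset.sum_congr rfl fun j _ => ?_
  rw [Matrix.mul_diagonal, Matrix.star_apply, mul_right_comm, ← starRingEnd_apply,
    Complex.mul_conj, ← Complex.ofReal_mul, Complex.ofReal_re]
  ring

lemma fcal_id {A : Matrix I I ℂ} (hA : A.IsHermitian) : fcal (fun x => x) A = A := by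
  rw [fcal_eq_cfc _ hA]
  exact cfc_id' ℝ A hA

lemma fcal_const_one {A : Matrix I I ℂ} (hA : A.IsHermitian) : fcal (fun _ => 1) A = 1 := by
  rw [fcal_eq_cfc _ hA]
  exact cfc_const_one ℝ A hA

lemma fcal_mul (f g : ℝ → ℝ) {A : Matrix I I ℂ} (hA : A.IsHermitian) :
    fcal f A * fcal g A = fcal (fun x => f x * g x) A := by
  rw [fcal_eq_cfc _ hA, fcal_eq_cfc _ hA, fcal_eq_cfc _ hA,
    cfc_mul _ _ _ (continuousOn_spectrum _ _) (continuousOn_spectrum _ _)]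

/-- **Klein's inequality** against a positive definite operator. -/
lemma trace_mul_mlog_le {ω X : Matrix I I ℂ} (hω : ω.PosSemidef) (hX : X.PosDef)
    (htr : (ω.trace).re = (X.trace).re) :
    ((ω * mlog X).trace).re ≤ ((ω * mlog ω).trace).re := by
  have hω' := hω.isHermitian
  have hX' := hX.isHermitian
  have e1 : ω * mlog ω =
      fcal (fun x => x * (if 0 < x then Real.logb 2 x else 0)) ω * fcal (fun _ => 1) X := by
    rw [fcal_const_one hX', Matrix.mul_one, ← fcal_mul _ _ hω', fcal_id hω', mlog]
  have e2 : ω * mlog X = fcal (fun x => x) ω *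
      fcal (fun x => if 0 < x then Real.logb 2 x else 0) X := by
    rw [fcal_id hω', mlog]
  have e3 : ω = fcal (fun x => x) ω * fcal (fun _ => 1) X := by
    rw [fcal_id hω', fcal_const_one hX', Matrix.mul_one]
  have e4 : X = fcal (fun _ => 1) ω * fcal (fun x => x) X := by
    rw [fcal_id hX', fcal_const_one hω', Matrix.one_mul]
  replace htr : ((fcal (fun x => x) ω * fcal (fun _ => 1) X).trace).re =
      ((fcal (fun _ => 1) ω * fcal (fun x => x) X).trace).re := by
    rw [← e3, ← e4, htr]
  rw [trace_fcal_mul_fcal _ _ hω' hX', trace_fcal_mul_fcal _ _ hω' hX'] at htr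
  rw [e1, e2, trace_fcal_mul_fcal _ _ hω' hX', trace_fcal_mul_fcal _ _ hω' hX']
  have hl2 : 0 < Real.log 2 := Real.log_pos one_lt_two
  have hterm : ∀ x y : ℝ, 0 ≤ x → 0 < y → x - y ≤ Real.log 2 *
      (x * (if 0 < x then Real.logb 2 x else 0) - x * (if 0 < y then Real.logb 2 y else 0)) := by
    intro x y hx hy
    rw [if_pos hy]
    rcases hx.eq_or_lt with rfl | hx
    · simpa using hy.le
    · rw [if_pos hx, Real.logb, Real.logb]
      have h := mul_le_mul_of_nonneg_left (Real.log_le_sub_one_of_pos (div_pos hy hx)) hx.le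
      rw [Real.log_div hy.ne' hx.ne', mul_sub, mul_sub, mul_div_cancel₀ _ hx.ne'] at h
      have : Real.log 2 * (x * (Real.log x / Real.log 2) - x * (Real.log y / Real.log 2)) =
          x * Real.log x - x * Real.log y := by
        field_simp
      linarith
  rw [← sub_eq_zero, ← Finset.sum_sub_distrib] at htr
  rw [← sub_nonneg, ← Finset.sum_sub_distrib]
  refine nonneg_of_mul_nonneg_right (a := Real.log 2) ?_ hl2
  refine htr.symm.le.trans ?_
  rw [Finset.mul_sum]
  refine Finset.sum_le_sum fun i _ => ?_
  rw [← Finset.sum_sub_distrib, ← Finset.sum_sub_distrib, Finset.mul_sum]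
  refine Finset.sum_le_sum fun j _ => ?_
  rw [← mul_sub, ← mul_sub, mul_left_comm, mul_one, mul_one, one_mul]
  exact mul_le_mul_of_nonneg_left (hterm _ _ (hω.eigenvalues_nonneg i) (hX.eigenvalues_pos j))
    (Complex.normSq_nonneg _)

lemma mul_eq_zero_of_suppLe {ω τ Q : Matrix I I ℂ} (h : SuppLe ω τ) (hQ : τ * Q = 0) :
    ω * Q = 0 := by
  ext i j
  have h1 : τ.mulVec (fun k => Q k j) = 0 := funext fun k => congrFun (congrFun hQ k) j
  exact congrFun (h _ h1) i

/-- Monotonicity of the logarithm in expectation, up to one bit, when the smaller operator may be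
singular outside the support of the state. -/
lemma trace_mul_mlog_le_of_smul_le {ω τ Y : Matrix I I ℂ} (hω : IsState ω) (hτ : τ.PosSemidef)
    (hsupp : SuppLe ω τ) (hY : Y.PosDef) {c : ℝ} (hc : 0 < c) (hle : c • τ ≤ Y) :
    ((ω * mlog τ).trace).re ≤ ((ω * mlog Y).trace).re - Real.logb 2 c + 1 := by
  obtain ⟨s, hs, hsY⟩ := exists_pos_smul_one_le hY
  have hτ' : IsSelfAdjoint τ := hτ.isHermitian
  set t : ℝ := s / c with ht_def
  have ht : 0 < t := div_pos hs hc
  set q : ℝ → ℝ := fun x => if 0 < x then 0 else 1 with hq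
  set f : ℝ → ℝ := fun x => if 0 < x then x else t with hf
  have hspec : ∀ x ∈ spectrum ℝ τ, 0 ≤ x := fun x hx => spectrum_nonneg_of_nonneg hτ.nonneg hx
  have hQ : τ * cfc q τ = 0 := by
    conv_lhs => enter [1]; rw [← cfc_id' ℝ τ hτ']
    rw [← cfc_mul _ _ _ (continuousOn_spectrum _ _) (continuousOn_spectrum _ _), ← cfc_zero ℝ τ]
    refine cfc_congr fun x hx => ?_
    rcases (hspec x hx).eq_or_lt with rfl | h
    · simp
    · simp [q, h]
  have hτs : cfc f τ = τ + t • cfc q τ := by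
    conv_rhs => enter [1]; rw [← cfc_id' ℝ τ hτ']
    rw [← cfc_smul _ _ _ (continuousOn_spectrum _ _),
      ← cfc_add _ _ _ (continuousOn_spectrum _ _) (continuousOn_spectrum _ _)]
    refine cfc_congr fun x hx => ?_
    rcases (hspec x hx).eq_or_lt with rfl | h
    · simp [f, q]
    · simp [f, q, h]
  have hpos : (cfc f τ).PosDef := by
    refine Matrix.isStrictlyPositive_iff_posDef.1 ((cfc_isStrictlyPositive_iff _ _
      (continuousOn_spectrum _ _) hτ').2 fun x _ => ?_)
    simp only [f]
    split_ifs with h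
    exacts [h, ht]
  have hlog : mlog (cfc f τ) = mlog τ + Real.logb 2 t • cfc q τ := by
    rw [mlog, mlog, fcal_eq_cfc _ hpos.isHermitian, fcal_eq_cfc _ hτ.isHermitian,
      ← cfc_smul _ _ _ (continuousOn_spectrum _ _),
      ← cfc_add _ _ _ (continuousOn_spectrum _ _) (continuousOn_spectrum _ _),
      ← cfc_comp' _ _ τ ((Matrix.finite_real_spectrum.image f).continuousOn _)
        (continuousOn_spectrum _ _) hτ']
    refine cfc_congr fun x hx => ?_
    rcases (hspec x hx).eq_or_lt with rfl | h
    · simp [f, q, ht]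
    · simp [f, q, h]
  have hq1 : cfc q τ ≤ 1 := by
    refine cfc_le_one q τ fun x _ => ?_
    simp only [q]
    split_ifs <;> norm_num
  have hle2 : c • cfc f τ ≤ (2 : ℝ) • Y := by
    have h1 : (c * t) • cfc q τ ≤ s • (1 : Matrix I I ℂ) := by
      rw [ht_def, mul_div_cancel₀ _ hc.ne']
      exact smul_le_smul_of_nonneg_left hq1 hs.le
    rw [hτs, smul_add, smul_smul, two_smul]
    exact add_le_add hle (h1.trans hsY)
  have hmono := trace_mul_re_mono hω.1.nonneg (mlog_mono (hpos.smul hc) hle2)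
  rw [mlog_smul hpos hc, mlog_smul hY two_pos, hlog, Matrix.mul_add, Matrix.mul_add,
    Matrix.mul_add, Matrix.mul_smul, Matrix.mul_smul, Matrix.mul_smul,
    mul_eq_zero_of_suppLe hsupp hQ, Matrix.mul_one] at hmono
  simp only [Matrix.trace_add, Matrix.trace_smul, hω.2, Complex.add_re, Complex.real_smul,
    mul_one, Complex.ofReal_re, Matrix.trace_zero, mul_zero, Complex.zero_re] at hmono
  rw [Real.logb_self_eq_one one_lt_two] at hmono
  linarith

end MatrixLog

section SiteMap

open scoped MatrixOrder Matrix.Norms.L2Operator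

variable {ι A : Type*} [Fintype ι] [DecidableEq ι] [Fintype A] [DecidableEq A]

/-- Trace out site `k` and put the operator `B` in its place. -/
def siteMap (B : Matrix A A ℂ) (k : ι) :
    Matrix (ι → A) (ι → A) ℂ →ₗ[ℂ] Matrix (ι → A) (ι → A) ℂ where
  toFun X := fun x y =>
    B (x k) (y k) * ∑ a, X (Function.update x k a) (Function.update y k a)
  map_add' X Y := by
    funext x y
    exact (by simp [Finset.sum_add_distrib, mul_add] :
      B (x k) (y k) * ∑ a, (X + Y) (Function.update x k a) (Function.update y k a) =
        B (x k) (y k) * ∑ a, X (Function.update x k a) (Function.update y k a) +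
        B (x k) (y k) * ∑ a, Y (Function.update x k a) (Function.update y k a))
  map_smul' c X := by
    funext x y
    exact (by simp [← Finset.mul_sum, mul_left_comm] :
      B (x k) (y k) * ∑ a, (c • X) (Function.update x k a) (Function.update y k a) =
        c * (B (x k) (y k) * ∑ a, X (Function.update x k a) (Function.update y k a)))

lemma siteMap_apply (B : Matrix A A ℂ) (k : ι) (X : Matrix (ι → A) (ι → A) ℂ) (x y : ι → A) :
    siteMap B k X x y =
      B (x k) (y k) * ∑ a, X (Function.update x k a) (Function.update y k a) := rfl

lemma siteMap_eq_hadamard (B : Matrix A A ℂ) (k : ι) (X : Matrix (ι → A) (ι → A) ℂ) :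
    siteMap B k X = Matrix.hadamard (B.submatrix (fun x : ι → A => x k) (fun x => x k))
      (∑ a, X.submatrix (fun x => Function.update x k a) (fun x => Function.update x k a)) := by
  ext x y
  simp [siteMap_apply, Matrix.sum_apply]

lemma siteMap_nonneg {B : Matrix A A ℂ} (hB : 0 ≤ B) (k : ι) {X : Matrix (ι → A) (ι → A) ℂ}
    (hX : 0 ≤ X) : 0 ≤ siteMap B k X := by
  rw [Matrix.nonneg_iff_posSemidef] at *
  rw [siteMap_eq_hadamard]
  exact (hB.submatrix _).hadamard (Matrix.posSemidef_sum _ fun a _ => hX.submatrix _)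

lemma siteMap_mono {B : Matrix A A ℂ} (hB : 0 ≤ B) (k : ι) {X Y : Matrix (ι → A) (ι → A) ℂ}
    (hXY : X ≤ Y) : siteMap B k X ≤ siteMap B k Y := by
  rw [← sub_nonneg, ← map_sub]
  exact siteMap_nonneg hB k (sub_nonneg.2 hXY)

lemma smul_siteMap_one_le {B : Matrix A A ℂ} {c : ℝ} (hB : c • 1 ≤ B) (k : ι)
    {X : Matrix (ι → A) (ι → A) ℂ} (hX : 0 ≤ X) : c • siteMap 1 k X ≤ siteMap B k X := by
  rw [← sub_nonneg]
  convert siteMap_nonneg (sub_nonneg.2 hB) k hX using 1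
  ext x y
  simp only [siteMap_apply, Matrix.sub_apply, Matrix.smul_apply, sub_mul, smul_mul_assoc]

lemma siteMap_comm (B C : Matrix A A ℂ) {k l : ι} (h : k ≠ l) (X : Matrix (ι → A) (ι → A) ℂ) :
    siteMap B k (siteMap C l X) = siteMap C l (siteMap B k X) := by
  ext x y
  simp only [siteMap_apply, Function.update_of_ne h, Function.update_of_ne h.symm,
    ← Finset.mul_sum]
  rw [Finset.sum_comm, mul_left_comm]
  simp only [Function.update_comm h]

lemma siteMap_siteMap_self (B C : Matrix A A ℂ) (k : ι) (X : Matrix (ι → A) (ι → A) ℂ) :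
    siteMap B k (siteMap C k X) = C.trace • siteMap B k X := by
  ext x y
  simp only [siteMap_apply, Function.update_self, Function.update_idem, ← Finset.sum_mul,
    Matrix.smul_apply, smul_eq_mul, Matrix.trace, Matrix.diag]
  ring

/-- Exchanging the value at site `k` with an independent summation variable. -/
lemma sum_sum_update {R : Type*} [AddCommMonoid R] (k : ι) (F : (ι → A) → A → R) :
    ∑ x : ι → A, ∑ a, F (Function.update x k a) (x k) = ∑ x : ι → A, ∑ a, F x a := by
  rw [← Fintype.sum_prod_type', ← Fintype.sum_prod_type']
  have hinv : Function.Involutive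
      (fun p : (ι → A) × A => (Function.update p.1 k p.2, p.1 k)) := by
    rintro ⟨x, a⟩
    simp
  exact Fintype.sum_equiv hinv.toPerm _ _ fun p => rfl

lemma trace_siteMap (B : Matrix A A ℂ) (k : ι) (X : Matrix (ι → A) (ι → A) ℂ) :
    (siteMap B k X).trace = B.trace * X.trace := by
  have := sum_sum_update k (fun (x : ι → A) a => B a a * X x x)
  simp only [Matrix.trace, Matrix.diag, siteMap_apply, Finset.mul_sum]
  rw [this]
  simp only [← Finset.sum_mul, ← Finset.mul_sum]

/-- The operator `|b⟩⟨c|` acting on site `k`. -/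
def siteUnit (k : ι) (b c : A) : Matrix (ι → A) (ι → A) ℂ :=
  fun x y => if x k = b ∧ y = Function.update x k c then 1 else 0

lemma siteUnit_mul_apply (k : ι) (b c : A) (X : Matrix (ι → A) (ι → A) ℂ) (x y : ι → A) :
    (siteUnit k b c * X) x y = if x k = b then X (Function.update x k c) y else 0 := by
  rw [Matrix.mul_apply, Finset.sum_eq_single (Function.update x k c)]
  · simp [siteUnit]
  · intro z _ hz
    simp [siteUnit, hz]
  · simp

lemma conjTranspose_siteUnit (k : ι) (b c : A) :
    (siteUnit k b c).conjTranspose = siteUnit k c b := by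
  ext x y
  have h : (y k = b ∧ x = Function.update y k c) ↔ (x k = c ∧ y = Function.update x k b) := by
    constructor
    · rintro ⟨rfl, rfl⟩
      simp
    · rintro ⟨rfl, rfl⟩
      simp
  simp only [Matrix.conjTranspose_apply, siteUnit, h]
  split_ifs <;> simp

lemma mul_siteUnit_apply (k : ι) (b c : A) (X : Matrix (ι → A) (ι → A) ℂ) (x y : ι → A) :
    (X * siteUnit k b c) x y = if y k = c then X x (Function.update y k b) else 0 := by
  have h := siteUnit_mul_apply k c b X.conjTranspose y x
  rw [← conjTranspose_siteUnit, ← Matrix.conjTranspose_mul, Matrix.conjTranspose_apply] at h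
  have h' := congrArg star h
  rw [star_star] at h'
  rw [h']
  split_ifs <;> simp

lemma siteMap_one_eq_sum (k : ι) (X : Matrix (ι → A) (ι → A) ℂ) :
    siteMap 1 k X = ∑ b, ∑ c, siteUnit k b c * X * siteUnit k c b := by
  ext x y
  simp only [Matrix.sum_apply, mul_siteUnit_apply, siteUnit_mul_apply, siteMap_apply,
    Matrix.one_apply]
  symm
  rw [Finset.sum_eq_single (x k)]
  · by_cases h : x k = y k
    · simp [h]
    · simp [h, Ne.symm h]
  · intro b _ hb
    simp [Ne.symm hb]
  · simp

lemma siteUnit_mul_siteMap_one (k : ι) (b c : A) (X : Matrix (ι → A) (ι → A) ℂ) :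
    siteUnit k b c * siteMap 1 k X = siteMap 1 k X * siteUnit k b c := by
  ext x y
  simp only [siteUnit_mul_apply, mul_siteUnit_apply, siteMap_apply, Matrix.one_apply,
    Function.update_self, Function.update_idem]
  by_cases h1 : x k = b <;> by_cases h2 : y k = c <;> simp [h1, h2]
  exact fun h => absurd h.symm h2

lemma siteUnit_mul_siteUnit (k : ι) (b c : A) :
    siteUnit k c b * siteUnit k b c = siteUnit k c c := by
  ext x y
  rw [siteUnit_mul_apply]
  simp only [siteUnit, Function.update_self, true_and, Function.update_idem]
  by_cases h : x k = c <;> simp [h]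

lemma sum_siteUnit (k : ι) : ∑ c, siteUnit k c c = (1 : Matrix (ι → A) (ι → A) ℂ) := by
  ext x y
  rw [Matrix.sum_apply, Finset.sum_eq_single (x k)]
  · simp [siteUnit, Matrix.one_apply, eq_comm]
  · intro b _ hb
    simp [siteUnit, Ne.symm hb]
  · simp

/-- An operator with vanishing partial trace over site `k` is orthogonal to operators acting
trivially on that site. -/
lemma trace_mul_eq_zero_of_siteMap_one_eq_zero [Nonempty A] {k : ι}
    {D H : Matrix (ι → A) (ι → A) ℂ} (hD : siteMap 1 k D = 0)
    (hH : ∀ b c, Commute H (siteUnit k b c)) : (D * H).trace = 0 := by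
  have h1 : (siteMap 1 k D * H).trace = (Fintype.card A : ℂ) * (D * H).trace := by
    rw [siteMap_one_eq_sum]
    have hterm : ∀ b c : A, (siteUnit k b c * D * siteUnit k c b * H).trace =
        (D * H * siteUnit k c c).trace := by
      intro b c
      rw [Matrix.mul_assoc, ← (hH c b).eq, Matrix.mul_assoc, Matrix.trace_mul_comm,
        Matrix.mul_assoc, Matrix.mul_assoc, siteUnit_mul_siteUnit, Matrix.mul_assoc]
    simp only [Finset.sum_mul, Matrix.trace_sum, hterm]
    simp only [← Matrix.trace_sum, ← Finset.mul_sum, sum_siteUnit, Matrix.mul_one]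
    rw [Finset.sum_const, Finset.card_univ, Matrix.mul_smul, Matrix.trace_smul, nsmul_eq_mul]
  rw [hD, Matrix.zero_mul, Matrix.trace_zero, eq_comm, mul_eq_zero] at h1
  exact h1.resolve_left (Nat.cast_ne_zero.2 Fintype.card_ne_zero)

lemma mlog_siteMap_one_commute (k : ι) {X : Matrix (ι → A) (ι → A) ℂ}
    (hX : (siteMap 1 k X).IsHermitian) (b c : A) :
    Commute (mlog (siteMap 1 k X)) (siteUnit k b c) := by
  rw [mlog, fcal_eq_cfc _ hX]
  exact Commute.cfc_real (siteUnit_mul_siteMap_one k b c X).symm _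

lemma card_smul_one_sub_nonneg :
    0 ≤ (Fintype.card A : ℝ) • (1 : Matrix A A ℂ) - Matrix.of fun _ _ => 1 := by
  rw [Matrix.nonneg_iff_posSemidef]
  rcases isEmpty_or_nonempty A with hA | hA
  · rw [Subsingleton.elim (_ - _) (0 : Matrix A A ℂ)]
    exact Matrix.PosSemidef.zero
  have hd : (0 : ℝ) < Fintype.card A := Nat.cast_pos.2 Fintype.card_pos
  set M : Matrix A A ℂ := (Fintype.card A : ℝ) • (1 : Matrix A A ℂ) - Matrix.of fun _ _ => 1
    with hMdef
  have hMH : M.conjTranspose = M := by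
    ext i j
    by_cases h : i = j
    · simp [hMdef, h]
    · simp [hMdef, h, Ne.symm h]
  have hJ : (Matrix.of fun _ _ => 1 : Matrix A A ℂ) * (Matrix.of fun _ _ => 1) =
      (Fintype.card A : ℝ) • Matrix.of fun _ _ => 1 := by
    ext i j
    simp [Matrix.mul_apply]
  have hMM : M.conjTranspose * M = (Fintype.card A : ℝ) • M := by
    rw [hMH, hMdef, sub_mul, mul_sub, mul_sub, hJ]
    simp only [smul_mul_assoc, mul_smul_comm, one_mul, mul_one, smul_sub]
    abel
  have h := (Matrix.posSemidef_conjTranspose_mul_self M).smul (inv_nonneg.2 hd.le)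
  rwa [hMM, smul_smul, inv_mul_cancel₀ hd.ne', one_smul] at h

lemma le_card_smul_siteMap_one (k : ι) {X : Matrix (ι → A) (ι → A) ℂ} (hX : 0 ≤ X) :
    X ≤ (Fintype.card A : ℝ) • siteMap 1 k X := by
  have hterm : ∀ b c, 0 ≤ siteUnit k b c * X * siteUnit k c b := by
    intro b c
    rw [← conjTranspose_siteUnit k b c]
    exact Matrix.nonneg_iff_posSemidef.2
      ((Matrix.nonneg_iff_posSemidef.1 hX).mul_mul_conjTranspose_same _)
  have h1 : ∑ b, siteUnit k b b * X * siteUnit k b b ≤ siteMap 1 k X := by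
    rw [siteMap_one_eq_sum]
    exact Finset.sum_le_sum fun b _ =>
      Finset.single_le_sum (f := fun c => siteUnit k b c * X * siteUnit k c b)
        (fun c _ => hterm b c) (Finset.mem_univ b)
  have h2 : X ≤ (Fintype.card A : ℝ) • ∑ b, siteUnit k b b * X * siteUnit k b b := by
    rw [← sub_nonneg]
    have h3 := ((Matrix.nonneg_iff_posSemidef.1 (card_smul_one_sub_nonneg (A := A))).submatrix
      (fun x : ι → A => x k)).hadamard (Matrix.nonneg_iff_posSemidef.1 hX)
    rw [Matrix.nonneg_iff_posSemidef]
    convert h3 using 1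
    ext x y
    simp only [Matrix.sub_apply, Matrix.smul_apply, Matrix.sum_apply, mul_siteUnit_apply,
      siteUnit_mul_apply, Matrix.hadamard_apply, Matrix.submatrix_apply, Matrix.one_apply,
      Matrix.of_apply]
    by_cases h : x k = y k
    · have hx : Function.update x k (y k) = x := by simp [← h]
      simp [h, hx, sub_mul]
    · simp [h]
  exact h2.trans (smul_le_smul_of_nonneg_left h1 (Nat.cast_nonneg _))

end SiteMap

section SiteProducts

open scoped MatrixOrder Matrix.Norms.L2Operator

variable {ι A : Type*} [Fintype ι] [DecidableEq ι] [Fintype A] [DecidableEq A]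

lemma prod_map_apply_nonneg {f : ι → Module.End ℂ (Matrix I I ℂ)}
    (hf : ∀ k X, 0 ≤ X → 0 ≤ f k X) (l : List ι) {X : Matrix I I ℂ} (hX : 0 ≤ X) :
    0 ≤ (l.map f).prod X := by
  induction l with
  | nil => simpa using hX
  | cons k l ih => simpa using hf k _ ih

lemma prod_map_apply_mono {f : ι → Module.End ℂ (Matrix I I ℂ)}
    (hf : ∀ k X, 0 ≤ X → 0 ≤ f k X) (l : List ι) {X Y : Matrix I I ℂ} (hXY : X ≤ Y) :
    (l.map f).prod X ≤ (l.map f).prod Y := by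
  rw [← sub_nonneg, ← map_sub]
  exact prod_map_apply_nonneg hf l (sub_nonneg.2 hXY)

lemma trace_prod_map_apply {f : ι → Module.End ℂ (Matrix I I ℂ)}
    (hf : ∀ k X, (f k X).trace = X.trace) (l : List ι) (X : Matrix I I ℂ) :
    ((l.map f).prod X).trace = X.trace := by
  induction l with
  | nil => simp
  | cons k l ih => simpa [hf] using ih

lemma commute_siteMap (B C : Matrix A A ℂ) {k l : ι} (h : k ≠ l) :
    Commute (siteMap B k : Module.End ℂ (Matrix (ι → A) (ι → A) ℂ)) (siteMap C l) :=
  LinearMap.ext fun X => siteMap_comm B C h X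

lemma commute_siteMap_prod (B C : Matrix A A ℂ) {k : ι} {l : List ι} (h : k ∉ l) :
    Commute (siteMap B k : Module.End ℂ (Matrix (ι → A) (ι → A) ℂ))
      (l.map (siteMap C)).prod := by
  refine Commute.list_prod_right _ _ fun x hx => ?_
  obtain ⟨j, hj, rfl⟩ := List.mem_map.1 hx
  exact commute_siteMap B C fun hkj => h (hkj ▸ hj)

/-- Mixing site `k` with the state `σ` with weight `δ`. -/
def siteNoise (δ : ℝ) (σ : Matrix A A ℂ) (k : ι) : Module.End ℂ (Matrix (ι → A) (ι → A) ℂ) :=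
  (1 - δ) • 1 + δ • siteMap σ k

lemma siteNoise_apply (δ : ℝ) (σ : Matrix A A ℂ) (k : ι) (X : Matrix (ι → A) (ι → A) ℂ) :
    siteNoise δ σ k X = (1 - δ) • X + δ • siteMap σ k X := rfl

variable {δ : ℝ} {σ : Matrix A A ℂ}

lemma siteNoise_nonneg (hδ : 0 ≤ δ) (hδ' : δ ≤ 1) (hσ : 0 ≤ σ) (k : ι)
    (X : Matrix (ι → A) (ι → A) ℂ) (hX : 0 ≤ X) : 0 ≤ siteNoise δ σ k X :=
  add_nonneg (smul_nonneg (sub_nonneg.2 hδ') hX) (smul_nonneg hδ (siteMap_nonneg hσ k hX))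

lemma trace_siteNoise (hσ : σ.trace = 1) (k : ι) (X : Matrix (ι → A) (ι → A) ℂ) :
    (siteNoise δ σ k X).trace = X.trace := by
  rw [siteNoise_apply, Matrix.trace_add, Matrix.trace_smul, Matrix.trace_smul, trace_siteMap, hσ,
    one_mul, ← add_smul, sub_add_cancel, one_smul]

lemma commute_siteMap_siteNoise (B : Matrix A A ℂ) {k l : ι} (h : k ≠ l) :
    Commute (siteMap B k : Module.End ℂ (Matrix (ι → A) (ι → A) ℂ)) (siteNoise δ σ l) :=
  ((Commute.one_right _).smul_right _).add_right ((commute_siteMap B σ h).smul_right _)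

lemma smul_le_prod_siteNoise (hδ : 0 ≤ δ) (hδ' : δ ≤ 1) (hσ : 0 ≤ σ) (l : List ι)
    {X : Matrix (ι → A) (ι → A) ℂ} (hX : 0 ≤ X) :
    (1 - δ) ^ l.length • X ≤ (l.map (siteNoise δ σ)).prod X := by
  induction l with
  | nil => simp
  | cons k l ih =>
    have h0 := prod_map_apply_nonneg (siteNoise_nonneg hδ hδ' hσ) l hX
    rw [List.map_cons, List.prod_cons, Module.End.mul_apply, siteNoise_apply, List.length_cons,
      pow_succ', ← smul_smul]
    exact (smul_le_smul_of_nonneg_left ih (sub_nonneg.2 hδ')).trans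
      (le_add_of_nonneg_right (smul_nonneg hδ (siteMap_nonneg hσ k h0)))

lemma smul_siteMap_one_siteNoise_le (hδ : 0 ≤ δ) (hδ' : δ ≤ 1) (hσ : σ.trace = 1) {c : ℝ}
    (hc : c • 1 ≤ σ) (k : ι) {X : Matrix (ι → A) (ι → A) ℂ} (hX : 0 ≤ X) :
    (δ * c) • siteMap 1 k (siteNoise δ σ k X) ≤ siteNoise δ σ k X := by
  have h1 : siteMap 1 k (siteNoise δ σ k X) = siteMap 1 k X := by
    rw [siteNoise_apply, map_add, LinearMap.map_smul_of_tower, LinearMap.map_smul_of_tower,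
      siteMap_siteMap_self, hσ, one_smul, ← add_smul, sub_add_cancel, one_smul]
  rw [h1, siteNoise_apply, mul_smul]
  exact (smul_le_smul_of_nonneg_left (smul_siteMap_one_le hc k hX) hδ).trans
    (le_add_of_nonneg_left (smul_nonneg (sub_nonneg.2 hδ') hX))

lemma smul_siteMap_one_prod_siteNoise_le (hδ : 0 ≤ δ) (hδ' : δ ≤ 1) (hσ0 : 0 ≤ σ)
    (hσ : σ.trace = 1) {c : ℝ} (hc : c • 1 ≤ σ) (l : List ι) {k : ι} (hk : k ∈ l)
    {X : Matrix (ι → A) (ι → A) ℂ} (hX : 0 ≤ X) :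
    (δ * c) • siteMap 1 k ((l.map (siteNoise δ σ)).prod X) ≤
      (l.map (siteNoise δ σ)).prod X := by
  induction l with
  | nil => simp at hk
  | cons j l ih =>
    have h0 := prod_map_apply_nonneg (siteNoise_nonneg hδ hδ' hσ0) l hX
    rw [List.map_cons, List.prod_cons, Module.End.mul_apply]
    by_cases hkj : k = j
    · subst hkj
      exact smul_siteMap_one_siteNoise_le hδ hδ' hσ hc k h0
    · have h1 := ih ((List.mem_cons.1 hk).resolve_left hkj)
      have h2 := siteNoise_nonneg hδ hδ' hσ0 j _ (sub_nonneg.2 h1)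
      have h3 : siteMap 1 k (siteNoise δ σ j ((l.map (siteNoise δ σ)).prod X)) =
          siteNoise δ σ j (siteMap 1 k ((l.map (siteNoise δ σ)).prod X)) :=
        LinearMap.congr_fun (commute_siteMap_siteNoise 1 hkj).eq _
      rw [map_sub, sub_nonneg, LinearMap.map_smul_of_tower] at h2
      rwa [h3]

/-! ### Replacing all sites -/

variable {N : ℕ}

lemma siteMap_prodOp (B : Matrix A A ℂ) (k : Fin N) (G : Fin N → Matrix A A ℂ) :
    siteMap B k (prodOp G) = prodOp (Function.update G k ((G k).trace • B)) := by
  ext x y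
  have h1 : ∀ a, prodOp G (Function.update x k a) (Function.update y k a) =
      G k a a * ∏ i ∈ Finset.univ.erase k, G i (x i) (y i) := by
    intro a
    rw [prodOp, ← Finset.mul_prod_erase _ _ (Finset.mem_univ k)]
    congr 1
    · simp
    · refine Finset.prod_congr rfl fun i hi => ?_
      simp [Function.update_of_ne (Finset.ne_of_mem_erase hi)]
  have h2 : prodOp (Function.update G k ((G k).trace • B)) x y =
      (G k).trace * B (x k) (y k) * ∏ i ∈ Finset.univ.erase k, G i (x i) (y i) := by
    rw [prodOp, ← Finset.mul_prod_erase _ _ (Finset.mem_univ k)]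
    congr 1
    · simp
    · refine Finset.prod_congr rfl fun i hi => ?_
      simp [Function.update_of_ne (Finset.ne_of_mem_erase hi)]
  rw [h2, siteMap_apply]
  simp only [h1, ← Finset.sum_mul, Matrix.trace, Matrix.diag]
  ring

lemma prod_siteMap_prodOp (B : Matrix A A ℂ) (G : Fin N → Matrix A A ℂ) {l : List (Fin N)}
    (hl : l.Nodup) : (l.map (siteMap B)).prod (prodOp G) =
      prodOp fun j => if j ∈ l then (G j).trace • B else G j := by
  induction l with
  | nil => simp
  | cons k l ih =>
    rw [List.nodup_cons] at hl
    rw [List.map_cons, List.prod_cons, Module.End.mul_apply, ih hl.2, siteMap_prodOp]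
    congr 1
    funext j
    by_cases h : j = k
    · subst h
      simp [hl.1]
    · simp [h]

lemma prod_siteMap_finRange (B : Matrix A A ℂ) (X : Matrix (Fin N → A) (Fin N → A) ℂ) :
    ((List.finRange N).map (siteMap B)).prod X = X.trace • tpow B N := by
  induction X using Matrix.induction_on' with
  | h_zero => simp
  | h_add X Y hX hY => rw [map_add, hX, hY, Matrix.trace_add, add_smul]
  | h_std_basis u v c =>
    have h1 : Matrix.single u v c = c • prodOp fun i => Matrix.single (u i) (v i) (1 : ℂ) := by
      ext x y
      simp only [Matrix.single_apply, Matrix.smul_apply, prodOp, Finset.prod_ite_zero,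
        Finset.prod_const_one, funext_iff, forall_and, Finset.mem_univ, true_implies, smul_eq_mul,
        mul_ite, mul_one, mul_zero]
    have h2 : (Matrix.single u v c).trace =
        c * ∏ i, (Matrix.single (u i) (v i) (1 : ℂ)).trace := by
      have h3 : ∀ i, (Matrix.single (u i) (v i) (1 : ℂ)).trace = if u i = v i then 1 else 0 := by
        intro i
        split_ifs with h
        · rw [h, Matrix.trace_single_eq_same]
        · rw [Matrix.trace_single_eq_of_ne _ _ _ h]
      simp only [h3, Finset.prod_ite_zero, Finset.prod_const_one, Finset.mem_univ, true_implies]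
      split_ifs with h
      · rw [funext h, Matrix.trace_single_eq_same, mul_one]
      · rw [Matrix.trace_single_eq_of_ne _ _ _ fun h' => h (congrFun h'), mul_zero]
    rw [h2, h1, map_smul, prod_siteMap_prodOp B _ (List.nodup_finRange N), mul_smul]
    congr 1
    ext x y
    simp [prodOp, tpow, Finset.prod_mul_distrib]

lemma tpow_one : tpow (1 : Matrix A A ℂ) N = 1 := by
  ext x y
  simp only [tpow, Matrix.one_apply, Finset.prod_ite_zero, Finset.prod_const_one, funext_iff,
    Finset.mem_univ, true_implies]

lemma trace_tpow (B : Matrix A A ℂ) : (tpow B N).trace = B.trace ^ N := by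
  have := Finset.prod_univ_sum (fun _ : Fin N => (Finset.univ : Finset A)) fun _ a => B a a
  simpa [Matrix.trace, tpow] using this.symm

lemma isState_tpow [Nonempty A] {B : Matrix A A ℂ} (hB : IsState B) : IsState (tpow B N) := by
  have h0 : 0 ≤ B := Matrix.nonneg_iff_posSemidef.2 hB.1
  refine ⟨?_, by rw [trace_tpow, hB.2, one_pow]⟩
  obtain ⟨a⟩ := ‹Nonempty A›
  have h1 : 0 ≤ Matrix.diagonal (Pi.single (fun _ : Fin N => a) (1 : ℂ)) :=
    Matrix.nonneg_iff_posSemidef.2 (Matrix.PosSemidef.diagonal (Pi.single_nonneg.2 zero_le_one))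
  have h2 := prod_map_apply_nonneg (siteMap_nonneg h0) (List.finRange N) h1
  rwa [prod_siteMap_finRange, Matrix.trace_diagonal, Finset.sum_pi_single', if_pos
    (Finset.mem_univ _), one_smul, Matrix.nonneg_iff_posSemidef] at h2

lemma pow_smul_prod_siteMap_one_le {c : ℝ} (hc : 0 ≤ c) {Y : Matrix (ι → A) (ι → A) ℂ}
    (hY : ∀ k, c • siteMap 1 k Y ≤ Y) (l : List ι) :
    c ^ l.length • (l.map (siteMap 1)).prod Y ≤ Y := by
  induction l with
  | nil => simp
  | cons k l ih =>
    have h0 : 0 ≤ (1 : Matrix A A ℂ) := Matrix.nonneg_iff_posSemidef.2 Matrix.PosSemidef.one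
    have h1 := siteMap_mono h0 k ih
    rw [List.map_cons, List.prod_cons, Module.End.mul_apply, List.length_cons, pow_succ',
      ← smul_smul, ← LinearMap.map_smul_of_tower]
    exact (smul_le_smul_of_nonneg_left h1 hc).trans (hY k)

lemma pow_smul_one_le_of_smul_siteMap_one_le {c : ℝ} (hc : 0 < c)
    {Y : Matrix (Fin N → A) (Fin N → A) ℂ}
    (hYtr : Y.trace = 1) (hY : ∀ k, c • siteMap 1 k Y ≤ Y) : c ^ N • 1 ≤ Y := by
  have h := pow_smul_prod_siteMap_one_le hc.le hY (List.finRange N)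
  rwa [prod_siteMap_finRange, hYtr, one_smul, tpow_one, List.length_finRange] at h

lemma posDef_of_smul_one_le {c : ℝ} (hc : 0 < c) {Y : Matrix I I ℂ} (h : c • 1 ≤ Y) :
    Y.PosDef := by
  have h1 : ((c • (1 : Matrix I I ℂ)) + (Y - c • 1)).PosDef :=
    (Matrix.PosDef.one.smul hc).add_posSemidef (Matrix.nonneg_iff_posSemidef.1 (sub_nonneg.2 h))
  rwa [add_sub_cancel] at h1

lemma pow_smul_one_le_tpow [Nonempty A] {c : ℝ} (hc : 0 < c) {B : Matrix A A ℂ} (hB : IsState B)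
    (h : c • 1 ≤ B) : c ^ N • 1 ≤ tpow B N := by
  refine pow_smul_one_le_of_smul_siteMap_one_le hc (isState_tpow hB).2 fun k => ?_
  have h1 := smul_siteMap_one_le h k (Matrix.nonneg_iff_posSemidef.2 (isState_tpow (N := N) hB).1)
  have h2 : siteMap B k (tpow B N) = tpow B N := by
    have := siteMap_prodOp B k (fun _ : Fin N => B)
    rw [hB.2, one_smul, Function.update_eq_self] at this
    exact this
  rwa [h2] at h1

lemma le_pow_card_smul_one {X : Matrix (Fin N → A) (Fin N → A) ℂ} (hX : IsState X) :
    X ≤ (Fintype.card A : ℝ) ^ N • 1 := by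
  have h0 : 0 ≤ (1 : Matrix A A ℂ) := Matrix.nonneg_iff_posSemidef.2 Matrix.PosSemidef.one
  have hX0 := Matrix.nonneg_iff_posSemidef.2 hX.1
  have h : ∀ l : List (Fin N), X ≤ (Fintype.card A : ℝ) ^ l.length •
      (l.map (siteMap 1)).prod X := by
    intro l
    induction l with
    | nil => simp
    | cons k l ih =>
      have h1 := le_card_smul_siteMap_one k (prod_map_apply_nonneg (siteMap_nonneg h0) l hX0)
      rw [List.map_cons, List.prod_cons, Module.End.mul_apply, List.length_cons, pow_succ,
        ← smul_smul]
      exact ih.trans (smul_le_smul_of_nonneg_left h1 (by positivity))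
  have h2 := h (List.finRange N)
  rwa [prod_siteMap_finRange, hX.2, one_smul, tpow_one, List.length_finRange] at h2

/-! ### Lipschitz estimates for the logarithm -/

lemma abs_trace_mul_mlog_le [Nonempty A] {c : ℝ} (hc : 0 < c) {k : ι}
    {D W Y : Matrix (ι → A) (ι → A) ℂ} (hY : Y.PosDef) (hYk : c • siteMap 1 k Y ≤ Y)
    (hD : siteMap 1 k D = 0) (hDW : D ≤ W) (hWD : -W ≤ D) :
    |((D * mlog Y).trace).re| ≤
      max |Real.logb 2 c| (Real.logb 2 (Fintype.card A)) * (W.trace).re := by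
  have hd : (0 : ℝ) < Fintype.card A := Nat.cast_pos.2 Fintype.card_pos
  have hY0 := Matrix.nonneg_iff_posSemidef.2 hY.posSemidef
  have hYZ := le_card_smul_siteMap_one k hY0
  have hZ : (siteMap 1 k Y).PosDef := by
    obtain ⟨b, hb, hbY⟩ := exists_pos_smul_one_le hY
    refine posDef_of_smul_one_le (mul_pos (inv_pos.2 hd) hb) ?_
    have h := smul_le_smul_of_nonneg_left (hbY.trans hYZ) (inv_nonneg.2 hd.le)
    rwa [smul_smul, smul_smul, inv_mul_cancel₀ hd.ne', one_smul] at h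
  have h0 : (D * mlog (siteMap 1 k Y)).trace = 0 :=
    trace_mul_eq_zero_of_siteMap_one_eq_zero hD (mlog_siteMap_one_commute k hZ.isHermitian)
  have h1 : (D * mlog Y).trace = (D * (mlog Y - mlog (siteMap 1 k Y))).trace := by
    rw [mul_sub, Matrix.trace_sub, h0, sub_zero]
  have hup : mlog Y - mlog (siteMap 1 k Y) ≤ Real.logb 2 (Fintype.card A) • 1 := by
    rw [sub_le_iff_le_add, ← mlog_smul hZ hd]
    exact mlog_mono hY hYZ
  have hlow : Real.logb 2 c • 1 ≤ mlog Y - mlog (siteMap 1 k Y) := by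
    rw [le_sub_iff_add_le, ← mlog_smul hZ hc]
    exact mlog_mono (hZ.smul hc) hYk
  have hone : 0 ≤ (1 : Matrix (ι → A) (ι → A) ℂ) :=
    Matrix.nonneg_iff_posSemidef.2 Matrix.PosSemidef.one
  rw [h1]
  refine trace_mul_re_le_of_dominated hDW hWD
    (hup.trans (smul_le_smul_of_nonneg_right (le_max_right _ _) hone)) ?_
  rw [← neg_smul]
  exact (smul_le_smul_of_nonneg_right
    (neg_le.1 ((neg_le_abs _).trans (le_max_left _ _))) hone).trans hlow

lemma abs_trace_sub_prod_siteMap_mul_mlog_le [Nonempty A] {c : ℝ} (hc : 0 < c)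
    {Y : Matrix (ι → A) (ι → A) ℂ} (hY : Y.PosDef) (hYk : ∀ k, c • siteMap 1 k Y ≤ Y)
    {B : Matrix A A ℂ} (hB : IsState B) {X : Matrix (ι → A) (ι → A) ℂ}
    {W : ι → Matrix (ι → A) (ι → A) ℂ} (hXW : ∀ k, X - siteMap B k X ≤ W k)
    (hWX : ∀ k, -W k ≤ X - siteMap B k X) {l : List ι} (hl : l.Nodup) :
    |(((X - (l.map (siteMap B)).prod X) * mlog Y).trace).re| ≤
      max |Real.logb 2 c| (Real.logb 2 (Fintype.card A)) *
        (l.map fun k => ((W k).trace).re).sum := by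
  have hB0 := Matrix.nonneg_iff_posSemidef.2 hB.1
  induction l with
  | nil => simp
  | cons k l ih =>
    rw [List.nodup_cons] at hl
    set R := (l.map (siteMap B)).prod with hR
    have hcomm : ∀ C, ∀ Z, siteMap C k (R Z) = R (siteMap C k Z) := fun C Z =>
      LinearMap.congr_fun (commute_siteMap_prod C B hl.1).eq Z
    have hsplit : X - ((k :: l).map (siteMap B)).prod X =
        (X - R X) + R (X - siteMap B k X) := by
      rw [List.map_cons, List.prod_cons, Module.End.mul_apply, ← hR, hcomm, map_sub]
      abel
    have hZ : siteMap 1 k (R (X - siteMap B k X)) = 0 := by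
      rw [hcomm, map_sub, siteMap_siteMap_self, hB.2, one_smul, sub_self, map_zero]
    have h1 : R (X - siteMap B k X) ≤ R (W k) := prod_map_apply_mono (siteMap_nonneg hB0) l (hXW k)
    have h2 : -R (W k) ≤ R (X - siteMap B k X) := by
      rw [← map_neg]
      exact prod_map_apply_mono (siteMap_nonneg hB0) l (hWX k)
    have h3 := abs_trace_mul_mlog_le hc hY (hYk k) hZ h1 h2
    rw [hR, trace_prod_map_apply (fun j Z => by rw [trace_siteMap, hB.2, one_mul]), ← hR] at h3
    rw [hsplit, add_mul, Matrix.trace_add, Complex.add_re, List.map_cons, List.sum_cons, mul_add,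
      add_comm (_ * (W k).trace.re)]
    exact (abs_add_le _ _).trans (add_le_add (ih hl.2) h3)

end SiteProducts

section GoodFamily

variable {d : ℕ} {σ : Matrix (Fin d) (Fin d) ℂ}
  {M : ∀ n : ℕ, Set (Matrix (Fin n → Fin d) (Fin n → Fin d) ℂ)}

lemma siteMap_eq_permute {n : ℕ} (B : Matrix I I ℂ) (k : Fin (n + 1))
    (X : Matrix (Fin (n + 1) → I) (Fin (n + 1) → I) ℂ) :
    siteMap B k X = permute (finSuccEquivLast.trans (finSuccEquiv' k).symm)
      (tprod (ptraceAt k X) (tpow B 1)) := by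
  ext x y
  have h1 : ∀ (z : Fin (n + 1) → I) (a : I),
      k.insertNth a (fun i : Fin n => (z ∘ (finSuccEquivLast.trans (finSuccEquiv' k).symm))
        (Fin.castAdd 1 i)) = Function.update z k a := by
    intro z a
    have h2 : (fun i : Fin n => (z ∘ (finSuccEquivLast.trans (finSuccEquiv' k).symm))
        (Fin.castAdd 1 i)) = k.removeNth z := by
      funext i
      have h3 : Fin.castAdd 1 i = i.castSucc := rfl
      simp [h3, Fin.removeNth]
    rw [h2, Fin.insertNth_removeNth]
  have h4 : ∀ j : Fin 1, Fin.natAdd n j = Fin.last n := by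
    intro j
    ext
    simp
  rw [siteMap_apply, permute, tprod, ptraceAt, mul_comm]
  simp only [h1]
  simp [tpow, h4]

namespace GoodFamily

lemma nonempty (hM : GoodFamily σ M) : Nonempty (Fin d) := by
  by_contra h
  rw [not_nonempty_iff] at h
  have := hM.sigma_state.2
  simp [Matrix.trace] at this

lemma siteMap_mem (hM : GoodFamily σ M) {N : ℕ} (k : Fin N)
    {X : Matrix (Fin N → Fin d) (Fin N → Fin d) ℂ} (hX : X ∈ M N) : siteMap σ k X ∈ M N := by
  cases N with
  | zero => exact k.elim0
  | succ n =>
    rw [siteMap_eq_permute]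
    exact hM.perm_mem _ _ _ (hM.tprod_mem _ _ _ (hM.ptrace_mem n k X hX) _ (hM.sigma_mem 1))

lemma prod_siteNoise_mem (hM : GoodFamily σ M) {δ : ℝ} (hδ : 0 ≤ δ) (hδ' : δ ≤ 1) {N : ℕ}
    (l : List (Fin N)) {X : Matrix (Fin N → Fin d) (Fin N → Fin d) ℂ} (hX : X ∈ M N) :
    (l.map (siteNoise δ σ)).prod X ∈ M N := by
  induction l with
  | nil => simpa using hX
  | cons k l ih =>
    rw [List.map_cons, List.prod_cons, Module.End.mul_apply, siteNoise_apply]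
    exact hM.convex N ih (hM.siteMap_mem k ih) (sub_nonneg.2 hδ') hδ (by ring)

end GoodFamily

end GoodFamily

section CommutingProjections

/-- For commuting orthogonal projections `P k`, a superposition of vectors each of which is fixed
by all but at most `r` of them has expected number of defects at most `r`. -/
lemma sum_defect_le {ι R V : Type*} [DecidableEq ι] [Ring R] [AddCommGroup V] [Module R V]
    {q : V → ℝ} (hq : ∀ v, 0 ≤ q v) {P : ι → V →ₗ[R] V}
    (hcomm : ∀ j k v, P j (P k v) = P k (P j v))
    (hpyth : ∀ k v, q v = q (P k v) + q (v - P k v)) (F : Finset ι) (r : ℕ) {v : V}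
    (hv : v ∈ Submodule.span R {f | ∃ S ⊆ F, (F \ S).card ≤ r ∧ ∀ k ∈ S, P k f = f}) :
    ∑ k ∈ F, q (v - P k v) ≤ r * q v := by
  have hq0 : ∀ k, q 0 = 0 := fun k => by simpa using hpyth k 0
  induction F using Finset.induction_on generalizing r v with
  | empty =>
    rw [Finset.sum_empty]
    exact mul_nonneg (Nat.cast_nonneg r) (hq v)
  | insert k F hk ih =>
    have ha : P k v ∈ Submodule.span R {f | ∃ S ⊆ F, (F \ S).card ≤ r ∧ ∀ k ∈ S, P k f = f} := by
      rw [← Submodule.mem_comap]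
      refine Submodule.span_le.2 ?_ hv
      rintro f ⟨S, hSF, hcard, hfix⟩
      refine Submodule.subset_span ⟨S ∩ F, Finset.inter_subset_right, ?_, fun j hj => ?_⟩
      · refine (Finset.card_le_card fun j hj => ?_).trans hcard
        simp only [Finset.mem_sdiff, Finset.mem_inter, Finset.mem_insert] at hj ⊢
        tauto
      · rw [hcomm, hfix j (Finset.mem_inter.1 hj).1]
    have hb : v - P k v ∈
        Submodule.span R {f | ∃ S ⊆ F, (F \ S).card + 1 ≤ r ∧ ∀ k ∈ S, P k f = f} := by
      have : v - P k v = (LinearMap.id - P k : V →ₗ[R] V) v := rfl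
      rw [this, ← Submodule.mem_comap]
      refine Submodule.span_le.2 ?_ hv
      rintro f ⟨S, hSF, hcard, hfix⟩
      rw [SetLike.mem_coe, Submodule.mem_comap, LinearMap.sub_apply, LinearMap.id_apply]
      by_cases hkS : k ∈ S
      · rw [hfix k hkS, sub_self]
        exact Submodule.zero_mem _
      · have hSF' : S ⊆ F := (Finset.subset_insert_iff_of_notMem hkS).1 hSF
        refine Submodule.subset_span ⟨S, hSF', ?_, fun j hj => ?_⟩
        · rwa [Finset.insert_sdiff_of_notMem _ hkS, Finset.card_insert_of_notMem] at hcard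
          exact fun h => hk (Finset.mem_sdiff.1 h).1
        · rw [map_sub, hcomm, hfix j hj]
    have hsplit : ∀ j, q (v - P j v) =
        q (P k v - P j (P k v)) + q ((v - P k v) - P j (v - P k v)) := by
      intro j
      rw [hpyth k (v - P j v)]
      congr 2
      · rw [map_sub, hcomm]
      · rw [map_sub, map_sub, hcomm k j]
        abel
    have iha := ih r ha
    have ihb : q (v - P k v) + ∑ j ∈ F, q ((v - P k v) - P j (v - P k v)) ≤
        r * q (v - P k v) := by
      cases r with
      | zero =>
        have hb0 : v - P k v = 0 := by simpa using hb
        simp [hb0, hq0 k]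
      | succ r =>
        have hb' := ih r (v := v - P k v) (by simpa only [Nat.add_le_add_iff_right] using hb)
        push_cast
        linarith
    rw [Finset.sum_insert hk, Finset.sum_congr rfl fun j _ => hsplit j, Finset.sum_add_distrib,
      hpyth k v, mul_add]
    linarith

end CommutingProjections

section SiteProjection

open scoped MatrixOrder Matrix.Norms.L2Operator

variable {ι J : Type*} [Fintype ι] [DecidableEq ι] [Fintype J] [DecidableEq J]

/-- Contraction of site `k` with `⟨θ|`. -/
def contractSite (θ : J → ℂ) (k : ι) (f : (ι → J) → ℂ) (x : ι → J) : ℂ :=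
  ∑ u, star (θ u) * f (Function.update x k u)

/-- The projection `|θ⟩⟨θ|` acting on site `k`. -/
def siteProj (θ : J → ℂ) (k : ι) : ((ι → J) → ℂ) →ₗ[ℂ] ((ι → J) → ℂ) where
  toFun f := fun x => θ (x k) * contractSite θ k f x
  map_add' f g := by
    funext x
    simp [contractSite, mul_add, Finset.sum_add_distrib]
  map_smul' c f := by
    funext x
    simp only [contractSite, Pi.smul_apply, smul_eq_mul, RingHom.id_apply, Finset.mul_sum]
    exact Finset.sum_congr rfl fun u _ => by ring

lemma siteProj_apply (θ : J → ℂ) (k : ι) (f : (ι → J) → ℂ) (x : ι → J) :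
    siteProj θ k f x = θ (x k) * contractSite θ k f x := rfl

lemma contractSite_update (θ : J → ℂ) (k : ι) (f : (ι → J) → ℂ) (x : ι → J) (u : J) :
    contractSite θ k f (Function.update x k u) = contractSite θ k f x := by
  simp [contractSite]

lemma siteProj_comm (θ : J → ℂ) (j k : ι) (f : (ι → J) → ℂ) :
    siteProj θ j (siteProj θ k f) = siteProj θ k (siteProj θ j f) := by
  by_cases h : j = k
  · rw [h]
  funext x
  simp only [siteProj_apply, contractSite, Function.update_of_ne h,
    Function.update_of_ne (Ne.symm h), Finset.mul_sum]
  rw [Finset.sum_comm]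
  refine Finset.sum_congr rfl fun u _ => Finset.sum_congr rfl fun v _ => ?_
  rw [Function.update_comm h]
  ring

lemma sum_star_mul_self {θ : J → ℂ} (hθ : vecNormSq θ = 1) : ∑ u, star (θ u) * θ u = 1 := by
  have h : ((vecNormSq θ : ℝ) : ℂ) = 1 := by rw [hθ, Complex.ofReal_one]
  rw [← h, vecNormSq, Complex.ofReal_sum]
  exact Finset.sum_congr rfl fun u _ => (Complex.normSq_eq_conj_mul_self).symm

lemma contractSite_siteProj {θ : J → ℂ} (hθ : vecNormSq θ = 1) (k : ι) (f : (ι → J) → ℂ) :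
    contractSite θ k (siteProj θ k f) = contractSite θ k f := by
  funext x
  rw [contractSite]
  simp only [siteProj_apply, Function.update_self, contractSite_update, ← mul_assoc,
    ← Finset.sum_mul]
  rw [sum_star_mul_self hθ, one_mul]

lemma siteProj_siteProj {θ : J → ℂ} (hθ : vecNormSq θ = 1) (k : ι) (f : (ι → J) → ℂ) :
    siteProj θ k (siteProj θ k f) = siteProj θ k f := by
  funext x
  rw [siteProj_apply, contractSite_siteProj hθ, siteProj_apply]

lemma contractSite_sub_siteProj {θ : J → ℂ} (hθ : vecNormSq θ = 1) (k : ι) (f : (ι → J) → ℂ) :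
    contractSite θ k (f - siteProj θ k f) = 0 := by
  have h := contractSite_siteProj hθ k f
  funext x
  have hx := congrFun h x
  simp only [contractSite, Pi.sub_apply, mul_sub, Finset.sum_sub_distrib, Pi.zero_apply] at hx ⊢
  rw [hx, sub_self]

lemma star_siteProj_dotProduct (θ : J → ℂ) (k : ι) (f g : (ι → J) → ℂ) :
    star (siteProj θ k f) ⬝ᵥ g = star f ⬝ᵥ siteProj θ k g := by
  have h := sum_sum_update k fun (x : ι → J) u =>
    θ (x k) * star (f x) * star (θ u) * g (Function.update x k u)
  simp only [Function.update_self, Function.update_idem, Function.update_eq_self] at h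
  simp only [dotProduct, Pi.star_apply, siteProj_apply, contractSite, star_mul', star_sum,
    star_star, Finset.mul_sum, Finset.sum_mul]
  convert h using 1
  · exact Finset.sum_congr rfl fun x _ => Finset.sum_congr rfl fun u _ => by ring
  · exact Finset.sum_congr rfl fun x _ => Finset.sum_congr rfl fun u _ => by ring

lemma vecNormSq_eq_dotProduct {K : Type*} [Fintype K] (f : K → ℂ) :
    vecNormSq f = (star f ⬝ᵥ f).re := by
  rw [vecNormSq, dotProduct, Complex.re_sum]
  refine Finset.sum_congr rfl fun x _ => ?_
  rw [Pi.star_apply, Complex.star_def, ← Complex.normSq_eq_conj_mul_self, Complex.ofReal_re]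

lemma vecNormSq_nonneg {K : Type*} [Fintype K] (f : K → ℂ) : 0 ≤ vecNormSq f :=
  Finset.sum_nonneg fun _ _ => Complex.normSq_nonneg _

lemma vecNormSq_eq_add_siteProj {θ : J → ℂ} (hθ : vecNormSq θ = 1) (k : ι) (f : (ι → J) → ℂ) :
    vecNormSq f = vecNormSq (siteProj θ k f) + vecNormSq (f - siteProj θ k f) := by
  have h1 : star (siteProj θ k f) ⬝ᵥ siteProj θ k f = star f ⬝ᵥ siteProj θ k f := by
    rw [star_siteProj_dotProduct, siteProj_siteProj hθ]
  simp only [vecNormSq_eq_dotProduct, star_sub, sub_dotProduct, dotProduct_sub,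
    star_siteProj_dotProduct, siteProj_siteProj hθ, Complex.sub_re]
  ring

lemma siteProj_eq_self_of_mem {N : ℕ} {θ : J → ℂ} (hθ : vecNormSq θ = 1) {S : Finset (Fin N)}
    (ψ : ({i : Fin N // i ∉ S} → J) → ℂ) {k : Fin N} (hk : k ∈ S) :
    siteProj θ k (fun x => (∏ i ∈ S, θ (x i)) * ψ (fun j => x j.1)) =
      fun x => (∏ i ∈ S, θ (x i)) * ψ (fun j => x j.1) := by
  funext x
  have h1 : ∀ u, ∏ i ∈ S, θ (Function.update x k u i) = θ u * ∏ i ∈ S.erase k, θ (x i) := by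
    intro u
    rw [← Finset.mul_prod_erase _ _ hk, Function.update_self]
    congr 1
    exact Finset.prod_congr rfl fun i hi => by
      rw [Function.update_of_ne (Finset.ne_of_mem_erase hi)]
  have h2 : ∀ u, (fun j : {i : Fin N // i ∉ S} => Function.update x k u j.1) =
      fun j => x j.1 := by
    intro u
    funext j
    rw [Function.update_of_ne fun h => j.2 (by rwa [h])]
  simp only [siteProj_apply, contractSite, h1, h2, ← mul_assoc, ← Finset.sum_mul]
  rw [sum_star_mul_self hθ, mul_one, Finset.mul_prod_erase _ (fun i => θ (x i)) hk]

lemma sum_vecNormSq_sub_siteProj_le {N r : ℕ} {θ : J → ℂ} (hθ : vecNormSq θ = 1)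
    {f : (Fin N → J) → ℂ} (hf : f ∈ Submodule.span ℂ (powVecSet θ N r)) :
    ∑ k, vecNormSq (f - siteProj θ k f) ≤ r * vecNormSq f := by
  refine sum_defect_le vecNormSq_nonneg (siteProj_comm θ) (vecNormSq_eq_add_siteProj hθ)
    Finset.univ r (Submodule.span_mono ?_ hf)
  rintro _ ⟨S, hS, ψ, rfl⟩
  refine ⟨S, Finset.subset_univ _, ?_, fun k hk => siteProj_eq_self_of_mem hθ ψ hk⟩
  rw [Finset.card_univ_sdiff, Fintype.card_fin, hS]
  omega

/-! ### Rank-one operators -/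

lemma vecOp_nonneg {K : Type*} [Fintype K] (f : K → ℂ) : 0 ≤ vecOp f :=
  Matrix.nonneg_iff_posSemidef.2 (Matrix.posSemidef_vecMulVec_self_star f)

lemma trace_vecOp {K : Type*} [Fintype K] (f : K → ℂ) : (vecOp f).trace = vecNormSq f := by
  rw [Matrix.trace, vecNormSq, Complex.ofReal_sum]
  exact Finset.sum_congr rfl fun x _ => Complex.mul_conj (f x)

lemma sub_siteMap_vecOp {θ : J → ℂ} (hθ : vecNormSq θ = 1) (k : ι) (f : (ι → J) → ℂ) :
    vecOp f - siteMap (vecOp θ) k (vecOp f) =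
      vecOp f - vecOp (siteProj θ k f) -
        siteMap (vecOp θ) k (vecOp (f - siteProj θ k f)) := by
  have key : siteMap (vecOp θ) k (vecOp f) =
      vecOp (siteProj θ k f) + siteMap (vecOp θ) k (vecOp (f - siteProj θ k f)) := by
    ext x y
    set g := f - siteProj θ k f with hg
    have hf : ∀ z, f z = siteProj θ k f z + g z := fun z => by simp [hg]
    have hC : ∀ z, ∑ u, star (θ u) * g (Function.update z k u) = 0 := fun z =>
      congrFun (contractSite_sub_siteProj hθ k f) z
    have hC' : ∀ z, ∑ u, θ u * star (g (Function.update z k u)) = 0 := fun z => by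
      have := congrArg star (hC z)
      simpa only [star_sum, star_mul', star_star, star_zero] using this
    have hsum : ∑ u, f (Function.update x k u) * star (f (Function.update y k u)) =
        contractSite θ k f x * star (contractSite θ k f y) +
          ∑ u, g (Function.update x k u) * star (g (Function.update y k u)) := by
      have h1 : ∀ u, f (Function.update x k u) * star (f (Function.update y k u)) =
          contractSite θ k f x * star (contractSite θ k f y) * (star (θ u) * θ u) +
          contractSite θ k f x * (θ u * star (g (Function.update y k u))) +
          star (contractSite θ k f y) * (star (θ u) * g (Function.update x k u)) +
          g (Function.update x k u) * star (g (Function.update y k u)) := by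
        intro u
        rw [hf (Function.update x k u), hf (Function.update y k u)]
        simp only [siteProj_apply, Function.update_self, contractSite_update, star_add, star_mul']
        ring
      simp only [h1, Finset.sum_add_distrib, ← Finset.mul_sum, hC, hC', sum_star_mul_self hθ]
      ring
    simp only [siteMap_apply, Matrix.add_apply, vecOp, siteProj_apply, star_mul']
    rw [hsum]
    ring
  rw [key, sub_add_eq_sub_sub]

/-- An operator dominating the disturbance of `|f⟩⟨f|` under resetting site `k` to `θ`. -/
def defectOp (θ : J → ℂ) (s : ℝ) (k : ι) (f : (ι → J) → ℂ) : Matrix (ι → J) (ι → J) ℂ :=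
  s • vecOp (siteProj θ k f) + (s⁻¹ + 1) • vecOp (f - siteProj θ k f) +
    siteMap (vecOp θ) k (vecOp (f - siteProj θ k f))

lemma defectOp_dominates {θ : J → ℂ} (hθ : vecNormSq θ = 1) {s : ℝ} (hs : 0 < s) (k : ι)
    (f : (ι → J) → ℂ) :
    vecOp f - siteMap (vecOp θ) k (vecOp f) ≤ defectOp θ s k f ∧
      -defectOp θ s k f ≤ vecOp f - siteMap (vecOp θ) k (vecOp f) := by
  have hs' : (s : ℂ) ≠ 0 := Complex.ofReal_ne_zero.2 hs.ne'
  rw [sub_siteMap_vecOp hθ, defectOp]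
  set a := siteProj θ k f
  set b := f - a with hb
  have hf : f = a + b := by simp [hb]
  set T := siteMap (vecOp θ) k (vecOp b)
  have hT : 0 ≤ T := siteMap_nonneg (vecOp_nonneg θ) k (vecOp_nonneg b)
  constructor
  · rw [← sub_nonneg]
    have h : s • vecOp a + (s⁻¹ + 1) • vecOp b + T - (vecOp f - vecOp a - T) =
        s • vecOp (a - (s⁻¹ : ℂ) • b) + (T + T) := by
      rw [hf]
      ext x y
      simp only [Matrix.add_apply, Matrix.sub_apply, Matrix.smul_apply, vecOp, Pi.add_apply,
        Pi.sub_apply, Pi.smul_apply, star_add, star_sub, star_mul', smul_eq_mul,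
        Complex.real_smul, Complex.star_def, map_inv₀, Complex.conj_ofReal, Complex.ofReal_add,
        Complex.ofReal_inv, Complex.ofReal_one]
      field_simp
      ring
    rw [h]
    exact add_nonneg (smul_nonneg hs.le (vecOp_nonneg _)) (add_nonneg hT hT)
  · rw [← sub_nonneg, sub_neg_eq_add]
    have h : vecOp f - vecOp a - T + (s • vecOp a + (s⁻¹ + 1) • vecOp b + T) =
        s • vecOp (a + (s⁻¹ : ℂ) • b) + (vecOp b + vecOp b) := by
      rw [hf]
      ext x y
      simp only [Matrix.add_apply, Matrix.sub_apply, Matrix.smul_apply, vecOp, Pi.add_apply,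
        Pi.smul_apply, star_add, star_mul', smul_eq_mul,
        Complex.real_smul, Complex.star_def, map_inv₀, Complex.conj_ofReal, Complex.ofReal_add,
        Complex.ofReal_inv, Complex.ofReal_one]
      field_simp
      ring
    rw [h]
    exact add_nonneg (smul_nonneg hs.le (vecOp_nonneg _))
      (add_nonneg (vecOp_nonneg _) (vecOp_nonneg _))

lemma trace_defectOp_le {θ : J → ℂ} (hθ : vecNormSq θ = 1) {s : ℝ} (hs : 0 < s) (k : ι)
    {f : (ι → J) → ℂ} (hf : vecNormSq f = 1) :
    ((defectOp θ s k f).trace).re ≤ s + (2 + s⁻¹) * vecNormSq (f - siteProj θ k f) := by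
  have h1 := vecNormSq_eq_add_siteProj hθ k f
  have h2 := vecNormSq_nonneg (f - siteProj θ k f)
  have h3 : vecNormSq (siteProj θ k f) ≤ 1 := by linarith
  rw [defectOp, Matrix.trace_add, Matrix.trace_add, Matrix.trace_smul, Matrix.trace_smul,
    trace_siteMap, trace_vecOp, trace_vecOp, trace_vecOp, hθ]
  simp only [Complex.real_smul, Complex.add_re, ← Complex.ofReal_mul, Complex.ofReal_re]
  nlinarith

end SiteProjection

section PartialTrace

open scoped MatrixOrder Matrix.Norms.L2Operator

variable {A E : Type*} [Fintype A] [DecidableEq A] [Fintype E] [DecidableEq E] {N : ℕ}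

lemma ptraceE_eq_sum (X : Matrix (Fin N → A × E) (Fin N → A × E) ℂ) :
    ptraceE X = ∑ e : Fin N → E, X.submatrix (fun x i => (x i, e i)) (fun x i => (x i, e i)) := by
  ext x y
  simp [ptraceE, Matrix.sum_apply]

lemma ptraceE_nonneg {X : Matrix (Fin N → A × E) (Fin N → A × E) ℂ} (hX : 0 ≤ X) :
    0 ≤ ptraceE X := by
  rw [ptraceE_eq_sum]
  exact Finset.sum_nonneg fun e _ => Matrix.nonneg_iff_posSemidef.2
    ((Matrix.nonneg_iff_posSemidef.1 hX).submatrix _)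

lemma ptraceE_sub (X Y : Matrix (Fin N → A × E) (Fin N → A × E) ℂ) :
    ptraceE (X - Y) = ptraceE X - ptraceE Y := by
  ext x y
  simp [ptraceE, Finset.sum_sub_distrib]

lemma ptraceE_neg (X : Matrix (Fin N → A × E) (Fin N → A × E) ℂ) :
    ptraceE (-X) = -ptraceE X := by
  ext x y
  simp [ptraceE]

lemma ptraceE_mono {X Y : Matrix (Fin N → A × E) (Fin N → A × E) ℂ} (h : X ≤ Y) :
    ptraceE X ≤ ptraceE Y := by
  rw [← sub_nonneg, ← ptraceE_sub]
  exact ptraceE_nonneg (sub_nonneg.2 h)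

lemma trace_ptraceE (X : Matrix (Fin N → A × E) (Fin N → A × E) ℂ) :
    (ptraceE X).trace = X.trace := by
  simp only [Matrix.trace, Matrix.diag, ptraceE]
  rw [← Fintype.sum_prod_type']
  exact (Fintype.sum_equiv (Equiv.arrowProdEquivProdArrow (Fin N) (fun _ => A) fun _ => E) _ _
    fun x => rfl).symm

lemma ptraceE_siteMap_vecOp {θ : A × E → ℂ} {ρ : Matrix A A ℂ}
    (hρ : ∀ a b, ρ a b = ∑ e, θ (a, e) * star (θ (b, e))) (k : Fin N)
    (X : Matrix (Fin N → A × E) (Fin N → A × E) ℂ) :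
    ptraceE (siteMap (vecOp θ) k X) = siteMap ρ k (ptraceE X) := by
  ext x y
  have h := sum_sum_update k fun (e : Fin N → E) u =>
    θ (x k, u) * star (θ (y k, u)) * ∑ a, X (fun i => (Function.update x k a i, e i))
      (fun i => (Function.update y k a i, e i))
  have hup : ∀ (z : Fin N → A) (e : Fin N → E) (a : A) (u : E),
      Function.update (fun i => (z i, e i)) k (a, u) =
        fun i => (Function.update z k a i, Function.update e k u i) := by
    intro z e a u
    funext i
    by_cases hi : i = k
    · subst hi
      simp
    · simp [hi]
  rw [siteMap_apply, hρ]
  simp only [ptraceE, siteMap_apply, vecOp, Fintype.sum_prod_type, hup]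
  rw [Finset.sum_comm (s := (Finset.univ : Finset A)), Finset.sum_mul_sum, Finset.sum_comm, ← h]
  refine Finset.sum_congr rfl fun e _ => ?_
  rw [Finset.sum_comm, Finset.mul_sum]

lemma isState_ptraceE_vecOp {f : (Fin N → A × E) → ℂ} (hf : vecNormSq f = 1) :
    IsState (ptraceE (vecOp f)) :=
  ⟨Matrix.nonneg_iff_posSemidef.1 (ptraceE_nonneg (vecOp_nonneg f)), by
    rw [trace_ptraceE, trace_vecOp, hf, Complex.ofReal_one]⟩

/-- The reduction of an almost power state is hardly disturbed by resetting single sites. -/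
lemma exists_dominating_of_mem_span_powVecSet {r : ℕ} {θ : A × E → ℂ} (hθ : vecNormSq θ = 1)
    {ρ : Matrix A A ℂ} (hρ : ∀ a b, ρ a b = ∑ e, θ (a, e) * star (θ (b, e)))
    {f : (Fin N → A × E) → ℂ} (hf : f ∈ Submodule.span ℂ (powVecSet θ N r))
    (hf1 : vecNormSq f = 1) {s : ℝ} (hs : 0 < s) :
    ∃ W : Fin N → Matrix (Fin N → A) (Fin N → A) ℂ,
      (∀ k, ptraceE (vecOp f) - siteMap ρ k (ptraceE (vecOp f)) ≤ W k) ∧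
      (∀ k, -W k ≤ ptraceE (vecOp f) - siteMap ρ k (ptraceE (vecOp f))) ∧
      ∑ k, ((W k).trace).re ≤ N * s + (2 + s⁻¹) * r := by
  refine ⟨fun k => ptraceE (defectOp θ s k f), fun k => ?_, fun k => ?_, ?_⟩
  · rw [← ptraceE_siteMap_vecOp hρ, ← ptraceE_sub]
    exact ptraceE_mono (defectOp_dominates hθ hs k f).1
  · rw [← ptraceE_siteMap_vecOp hρ, ← ptraceE_sub, ← ptraceE_neg]
    exact ptraceE_mono (defectOp_dominates hθ hs k f).2
  · simp only [trace_ptraceE]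
    have h := sum_vecNormSq_sub_siteProj_le hθ hf
    rw [hf1, mul_one] at h
    refine (Finset.sum_le_sum fun k _ => trace_defectOp_le hθ hs k hf1).trans ?_
    rw [Finset.sum_add_distrib, Finset.sum_const, Finset.card_univ, Fintype.card_fin,
      nsmul_eq_mul, ← Finset.mul_sum]
    gcongr

lemma isState_of_reduction {θ : A × E → ℂ} (hθ : vecNormSq θ = 1) {ρ : Matrix A A ℂ}
    (hρ : ∀ a b, ρ a b = ∑ e, θ (a, e) * star (θ (b, e))) : IsState ρ := by
  have h : ρ = ∑ e, vecOp fun a => θ (a, e) := by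
    ext a b
    simp [hρ, Matrix.sum_apply, vecOp]
  constructor
  · rw [h]
    exact Matrix.nonneg_iff_posSemidef.1 (Finset.sum_nonneg fun e _ => vecOp_nonneg _)
  · have h1 : ((vecNormSq θ : ℝ) : ℂ) = 1 := by rw [hθ, Complex.ofReal_one]
    rw [← h1, ← trace_vecOp]
    simp [Matrix.trace, hρ, vecOp, Fintype.sum_prod_type]

end PartialTrace

section EntropyBounds

open scoped MatrixOrder Matrix.Norms.L2Operator

lemma relEnt_eq_sub (X τ : Matrix I I ℂ) :
    relEnt X τ = ((X * mlog X).trace).re - ((X * mlog τ).trace).re := by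
  rw [relEnt, mul_sub, Matrix.trace_sub, Complex.sub_re]

lemma suppLe_of_posDef (X : Matrix I I ℂ) {Y : Matrix I I ℂ} (hY : Y.PosDef) : SuppLe X Y := by
  intro v hv
  rw [Matrix.eq_zero_of_mulVec_eq_zero hY.det_pos.ne' hv, Matrix.mulVec_zero]

variable {A : Type*} [Fintype A] [DecidableEq A] [Nonempty A] {N : ℕ}

lemma trace_mul_mlog_le_mul_logb_card {X τ : Matrix (Fin N → A) (Fin N → A) ℂ} (hX : IsState X)
    (hτ : IsState τ) (h : SuppLe X τ) :
    ((X * mlog τ).trace).re ≤ N * Real.logb 2 (Fintype.card A) + 1 := by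
  have hd : (0 : ℝ) < Fintype.card A := Nat.cast_pos.2 Fintype.card_pos
  have hc : (0 : ℝ) < ((Fintype.card A : ℝ) ^ N)⁻¹ := inv_pos.2 (pow_pos hd N)
  have hle : ((Fintype.card A : ℝ) ^ N)⁻¹ • τ ≤ 1 := by
    have h1 := smul_le_smul_of_nonneg_left (le_pow_card_smul_one hτ) hc.le
    rwa [smul_smul, inv_mul_cancel₀ (pow_pos hd N).ne', one_smul] at h1
  have h2 := trace_mul_mlog_le_of_smul_le hX hτ.1 h Matrix.PosDef.one hc hle
  rw [mlog_one, Matrix.mul_zero, Matrix.trace_zero, Complex.zero_re, Real.logb_inv,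
    Real.logb_pow] at h2
  linarith

variable {d : ℕ} {σ : Matrix (Fin d) (Fin d) ℂ}
  {M : ∀ n : ℕ, Set (Matrix (Fin n → Fin d) (Fin n → Fin d) ℂ)}

namespace GoodFamily

lemma EMset_le_relEnt (hM : GoodFamily σ M) {X τ : Matrix (Fin N → Fin d) (Fin N → Fin d) ℂ}
    (hX : IsState X) (hτ : τ ∈ M N) (h : SuppLe X τ) : EMset (M N) X ≤ relEnt X τ := by
  have := hM.nonempty
  refine csInf_le ⟨((X * mlog X).trace).re - (N * Real.logb 2 (Fintype.card (Fin d)) + 1), ?_⟩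
    ⟨τ, hτ, h, rfl⟩
  rintro _ ⟨τ', hτ', h', rfl⟩
  have := trace_mul_mlog_le_mul_logb_card hX (hM.states N τ' hτ') h'
  rw [relEnt_eq_sub]
  linarith

lemma EMset_le (hM : GoodFamily σ M) {c : ℝ} (hc : 0 < c) (hcσ : c • 1 ≤ σ)
    {X : Matrix (Fin N → Fin d) (Fin N → Fin d) ℂ} (hX : IsState X) :
    EMset (M N) X ≤ N * (Real.logb 2 d - Real.logb 2 c) + 1 := by
  have := hM.nonempty
  have h1 := pow_smul_one_le_tpow (N := N) hc hM.sigma_state hcσ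
  refine (hM.EMset_le_relEnt hX (hM.sigma_mem N)
    (suppLe_of_posDef X (posDef_of_smul_one_le (pow_pos hc N) h1))).trans ?_
  have h2 := trace_mul_mlog_le_mul_logb_card hX hX fun _ h => h
  have h3 := trace_mul_re_mono (Matrix.nonneg_iff_posSemidef.2 hX.1)
    (mlog_mono (Matrix.PosDef.one.smul (pow_pos hc N)) h1)
  rw [mlog_smul Matrix.PosDef.one (pow_pos hc N), mlog_one, add_zero, mul_smul_comm, mul_one,
    Matrix.trace_smul, hX.2, Complex.real_smul, mul_one, Complex.ofReal_re, Real.logb_pow] at h3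
  rw [Fintype.card_fin] at h2
  rw [relEnt_eq_sub]
  linarith

/-- Changing the first argument of the relative entropy from `tpow ρ N` to a nearby state. -/
lemma EMset_tpow_sub_le_relEnt (hM : GoodFamily σ M) {c δ : ℝ} (hc : 0 < c) (hcσ : c • 1 ≤ σ)
    (hδ : 0 < δ) (hδ' : δ < 1) {ρ : Matrix (Fin d) (Fin d) ℂ} (hρ : IsState ρ)
    {ω τ : Matrix (Fin N → Fin d) (Fin N → Fin d) ℂ} (hω : IsState ω)
    {W : Fin N → Matrix (Fin N → Fin d) (Fin N → Fin d) ℂ}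
    (hωW : ∀ k, ω - siteMap ρ k ω ≤ W k) (hWω : ∀ k, -W k ≤ ω - siteMap ρ k ω)
    (hτ : τ ∈ M N) (hωτ : SuppLe ω τ) :
    EMset (M N) (tpow ρ N) + 2 * (N * Real.logb 2 (1 - δ)) - 2 -
      2 * (max |Real.logb 2 (δ * c)| (Real.logb 2 d) * ∑ k, ((W k).trace).re) ≤
      relEnt ω τ := by
  have := hM.nonempty
  have hσ0 : 0 ≤ σ := Matrix.nonneg_iff_posSemidef.2 hM.sigma_state.1
  have hδc : 0 < δ * c := mul_pos hδ hc
  have hδN : 0 < (1 - δ) ^ N := pow_pos (sub_pos.2 hδ') N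
  set L := ((List.finRange N).map (siteNoise δ σ)).prod with hL
  have hnoise : ∀ X, IsState X → (L X).trace = 1 ∧ (∀ k, (δ * c) • siteMap 1 k (L X) ≤ L X) ∧
      (L X).PosDef ∧ (1 - δ) ^ N • X ≤ L X := by
    intro X hX
    have hX0 := Matrix.nonneg_iff_posSemidef.2 hX.1
    have htr : (L X).trace = 1 := by
      rw [hL, trace_prod_map_apply (trace_siteNoise hM.sigma_state.2), hX.2]
    have hk : ∀ k, (δ * c) • siteMap 1 k (L X) ≤ L X := fun k =>
      smul_siteMap_one_prod_siteNoise_le hδ.le hδ'.le hσ0 hM.sigma_state.2 hcσ _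
        (List.mem_finRange k) hX0
    have hle := smul_le_prod_siteNoise hδ.le hδ'.le hσ0 (List.finRange N) hX0
    rw [List.length_finRange] at hle
    exact ⟨htr, hk, posDef_of_smul_one_le (pow_pos hδc N)
      (pow_smul_one_le_of_smul_siteMap_one_le hδc htr hk), hle⟩
  have hswap : ∀ Y : Matrix (Fin N → Fin d) (Fin N → Fin d) ℂ, Y.PosDef →
      (∀ k, (δ * c) • siteMap 1 k Y ≤ Y) →
      |((ω * mlog Y).trace).re - ((tpow ρ N * mlog Y).trace).re| ≤
        max |Real.logb 2 (δ * c)| (Real.logb 2 d) * ∑ k, ((W k).trace).re := by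
    intro Y hY hYk
    have h := abs_trace_sub_prod_siteMap_mul_mlog_le hδc hY hYk hρ hωW hWω (List.nodup_finRange N)
    rwa [prod_siteMap_finRange, hω.2, one_smul, sub_mul, Matrix.trace_sub, Complex.sub_re,
      ← List.ofFn_eq_map, List.sum_ofFn, Fintype.card_fin] at h
  have hρN : IsState (tpow ρ N) := isState_tpow hρ
  have hτs := hM.states N τ hτ
  obtain ⟨htr₁, hk₁, hpd₁, hle₁⟩ := hnoise _ hρN
  obtain ⟨-, hk₂, hpd₂, hle₂⟩ := hnoise _ hτs
  have e1 := trace_mul_mlog_le hω.1 hpd₁ (by rw [hω.2, htr₁])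
  have e2 := trace_mul_mlog_le_of_smul_le hω hτs.1 hωτ hpd₂ hδN hle₂
  have e3 := trace_mul_mlog_le_of_smul_le hρN hρN.1 (fun _ h => h) hpd₁ hδN hle₁
  have e4 := hM.EMset_le_relEnt hρN (hM.prod_siteNoise_mem hδ.le hδ'.le (List.finRange N) hτ)
    (suppLe_of_posDef _ hpd₂)
  have e5 := abs_le.1 (hswap _ hpd₁ hk₁)
  have e6 := abs_le.1 (hswap _ hpd₂ hk₂)
  rw [relEnt_eq_sub, ← hL] at e4
  rw [Real.logb_pow] at e2 e3
  rw [relEnt_eq_sub]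
  linarith [e5.1, e6.2]

lemma EMset_tpow_sub_le_EMset (hM : GoodFamily σ M) {c δ s : ℝ} (hc : 0 < c) (hcσ : c • 1 ≤ σ)
    (hδ : 0 < δ) (hδ' : δ < 1) (hs : 0 < s) {θ : Fin d × Fin d → ℂ} (hθ : vecNormSq θ = 1)
    {ρ : Matrix (Fin d) (Fin d) ℂ}
    (hρ : ∀ a b, ρ a b = ∑ e, θ (a, e) * star (θ (b, e))) {r : ℕ}
    {f : (Fin N → Fin d × Fin d) → ℂ} (hf : f ∈ Submodule.span ℂ (powVecSet θ N r))
    (hf1 : vecNormSq f = 1) :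
    EMset (M N) (tpow ρ N) + 2 * (N * Real.logb 2 (1 - δ)) - 2 -
      2 * (max |Real.logb 2 (δ * c)| (Real.logb 2 d) * (N * s + (2 + s⁻¹) * r)) ≤
      EMset (M N) (ptraceE (vecOp f)) := by
  have := hM.nonempty
  obtain ⟨W, hW, hW', hsum⟩ := exists_dominating_of_mem_span_powVecSet hθ hρ hf hf1 hs
  refine le_csInf ⟨_, tpow σ N, hM.sigma_mem N, suppLe_of_posDef _ (posDef_of_smul_one_le
    (pow_pos hc N) (pow_smul_one_le_tpow hc hM.sigma_state hcσ)), rfl⟩ ?_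
  rintro _ ⟨τ, hτ, hωτ, rfl⟩
  refine le_trans ?_ (hM.EMset_tpow_sub_le_relEnt hc hcσ hδ hδ' (isState_of_reduction hθ hρ)
    (isState_ptraceE_vecOp hf1) hW hW' hτ hωτ)
  gcongr

end GoodFamily

end EntropyBounds

lemma tendsto_div_one_of_add_eq {m p : ℕ → ℕ} (hp : ∀ n, m n + p n = n)
    (hm : Tendsto (fun n : ℕ => (m n : ℝ) / n) atTop (nhds 0)) :
    Tendsto (fun n : ℕ => (p n : ℝ) / n) atTop (nhds 1) := by
  have h : Tendsto (fun n : ℕ => 1 - (m n : ℝ) / n) atTop (nhds 1) := by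
    simpa using hm.const_sub 1
  refine h.congr' ?_
  filter_upwards [eventually_gt_atTop 0] with n hn
  have hn' : (n : ℝ) ≠ 0 := Nat.cast_ne_zero.2 hn.ne'
  have hmp : (m n : ℝ) + p n = n := mod_cast hp n
  field_simp
  linarith

lemma tendsto_atTop_of_tendsto_div_one {p : ℕ → ℕ}
    (h : Tendsto (fun n : ℕ => (p n : ℝ) / n) atTop (nhds 1)) : Tendsto p atTop atTop := by
  rw [← tendsto_natCast_atTop_iff (R := ℝ)]
  refine (h.pos_mul_atTop one_pos tendsto_natCast_atTop_atTop).congr' ?_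
  filter_upwards [eventually_gt_atTop 0] with n hn
  exact div_mul_cancel₀ _ (Nat.cast_ne_zero.2 hn.ne')

lemma exists_logb_one_sub_gt {ε : ℝ} (hε : 0 < ε) :
    ∃ δ : ℝ, 0 < δ ∧ δ < 1 ∧ -ε < Real.logb 2 (1 - δ) := by
  refine ⟨1 - 2 ^ (-(ε / 2)), sub_pos.2 (Real.rpow_lt_one_of_one_lt_of_neg one_lt_two (by linarith)),
    sub_lt_self _ (by positivity), ?_⟩
  rw [sub_sub_cancel, Real.logb_rpow two_pos (by norm_num)]
  linarith

/-- **Lemma (non-lockability along almost power states).**  Let `θ ∈ ℋ ⊗ ℋ_E` be a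
unit vector with reduced state `ρ` satisfying `λ_max(ρ) < 1` (i.e. `1 − ρ` is positive
definite), let `{M n}` satisfy properties 1–5, let `m = o(n)` and `r = o(n)` with
`p n = n − m n`, and let `Ψ n` be unit almost power states in
`|θ⟩^{[⊗, p n, r n]}`.  Then, with `E = E_M^∞(ρ)`,
`E ≤ liminf_n (1/n) E_{M_{p n}}(tr_E |Ψ n⟩⟨Ψ n|)`. -/
theorem nonlockability_almost_power {d : ℕ} (σ : Matrix (Fin d) (Fin d) ℂ)
    (M : ∀ n : ℕ, Set (Matrix (Fin n → Fin d) (Fin n → Fin d) ℂ))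
    (hM : GoodFamily σ M)
    (θ : Fin d × Fin d → ℂ) (hθ : vecNormSq θ = 1)
    (ρ : Matrix (Fin d) (Fin d) ℂ)
    (hρred : ∀ a b : Fin d, ρ a b = ∑ e : Fin d, θ (a, e) * star (θ (b, e)))
    (hmax : ((1 : Matrix (Fin d) (Fin d) ℂ) - ρ).PosDef)
    (m r p : ℕ → ℕ) (hp : ∀ n, m n + p n = n)
    (hm : Filter.Tendsto (fun n : ℕ => (m n : ℝ) / n) Filter.atTop (nhds 0))
    (hr : Filter.Tendsto (fun n : ℕ => (r n : ℝ) / n) Filter.atTop (nhds 0))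
    (Ψ : ∀ n : ℕ, (Fin (p n) → Fin d × Fin d) → ℂ)
    (hΨ : ∀ n, Ψ n ∈ almostPower θ (p n) (r n) ∧ vecNormSq (Ψ n) = 1)
    (E : ℝ)
    (hE : Filter.Tendsto (fun n : ℕ => EMset (M n) (tpow ρ n) / n) Filter.atTop (nhds E)) :
    E ≤ Filter.liminf
      (fun n : ℕ => EMset (M (p n)) (ptraceE (vecOp (Ψ n))) / n) Filter.atTop := by
  obtain ⟨c, hc, hcσ⟩ := exists_pos_smul_one_le hM.sigma_posdef
  have hpn := tendsto_div_one_of_add_eq hp hm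
  have hpt := tendsto_atTop_of_tendsto_div_one hpn
  have hcob : IsCoboundedUnder (· ≥ ·) atTop
      fun n : ℕ => EMset (M (p n)) (ptraceE (vecOp (Ψ n))) / n := by
    refine IsBoundedUnder.isCoboundedUnder_ge ⟨|Real.logb 2 d - Real.logb 2 c| + 1, ?_⟩
    rw [eventually_map]
    filter_upwards [eventually_gt_atTop 0] with n hn
    have hn1 : (1 : ℝ) ≤ n := Nat.one_le_cast.2 hn
    have hpnn : (p n : ℝ) ≤ n := Nat.cast_le.2 (by have := hp n; omega)
    have h1 := hM.EMset_le hc hcσ (isState_ptraceE_vecOp (hΨ n).2)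
    rw [div_le_iff₀ (by linarith)]
    refine h1.trans ?_
    have h2 : (p n : ℝ) * (Real.logb 2 d - Real.logb 2 c) ≤
        n * |Real.logb 2 d - Real.logb 2 c| :=
      (mul_le_mul_of_nonneg_left (le_abs_self _) (Nat.cast_nonneg _)).trans
        (mul_le_mul_of_nonneg_right hpnn (abs_nonneg _))
    linarith
  refine le_of_forall_pos_le_add fun ε hε => ?_
  rw [← sub_le_iff_le_add]
  obtain ⟨δ, hδ, hδ', hlog⟩ := exists_logb_one_sub_gt (show 0 < ε / 4 by linarith)
  set L := max |Real.logb 2 (δ * c)| (Real.logb 2 d)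
  have hL : 0 ≤ L := le_max_of_le_left (abs_nonneg _)
  obtain ⟨s, hs, hLs⟩ : ∃ s : ℝ, 0 < s ∧ L * s < ε / 4 := by
    refine ⟨ε / 4 / (L + 1), by positivity, ?_⟩
    rw [← mul_div_assoc, div_lt_iff₀ (by linarith)]
    nlinarith
  have hlim : Tendsto (fun n : ℕ => EMset (M (p n)) (tpow ρ (p n)) / p n * ((p n : ℝ) / n) +
      2 * ((p n : ℝ) / n * Real.logb 2 (1 - δ)) - 2 * (n : ℝ)⁻¹ -
      2 * (L * ((p n : ℝ) / n * s + (2 + s⁻¹) * ((r n : ℝ) / n)))) atTop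
      (nhds (E * 1 + 2 * (1 * Real.logb 2 (1 - δ)) - 2 * 0 -
        2 * (L * (1 * s + (2 + s⁻¹) * 0)))) :=
    ((((hE.comp hpt).mul hpn).add ((hpn.mul_const _).const_mul 2)).sub
      (tendsto_inv_atTop_nhds_zero_nat.const_mul 2)).sub
      ((((hpn.mul_const s).add (hr.const_mul _)).const_mul L).const_mul 2)
  refine le_liminf_of_le hcob ?_
  filter_upwards [hlim.eventually_const_lt (show E - ε < _ by nlinarith),
    eventually_gt_atTop 0, hpt.eventually_gt_atTop 0] with n hn hn0 hpn0
  refine hn.le.trans ?_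
  have hn' : (0 : ℝ) < n := Nat.cast_pos.2 hn0
  have hp' : (p n : ℝ) ≠ 0 := Nat.cast_ne_zero.2 hpn0.ne'
  have h := hM.EMset_tpow_sub_le_EMset hc hcσ hδ hδ' hs hθ hρred (hΨ n).1.2 (hΨ n).2
  rw [le_div_iff₀ hn']
  refine le_trans (le_of_eq ?_) h
  field_simp
  ring
end GQSL
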